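/- Let A = kQ/I be a non simply connected toupie algebra with m = dim_k e_0 A e_∞ > 0. If A is weakly shod, then every IP-path in ind A is trivial (has length zero). -/

import Mathlib

/-!
Formalization preamble for "Toupie algebras".

We realize the bound quiver algebra `A = kQ/I` of a toupie quiver `Q` concretely:
the path algebra `kQ` is realized, via its (faithful) left regular representation,
as the subalgebra of `Module.End k (paths → k)` generated by the operators of left
multiplication by the trivial paths `e_v` and by the arrows of `Q`.  Paths are
composed from left to right (`p * q` = "first `p`, then `q`"), as in
Assem–Simson–Skowroński, so that paths from the source `0` to the sink `∞` span
`e₀ (kQ) e∞`, and (right) `A`-modules are identified with representations of `(Q, I)`.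
Right `A`-modules are formalized as (left) modules over `Aᵐᵒᵖ`.
-/

set_option synthInstance.maxHeartbeats 400000
set_option maxHeartbeats 800000

noncomputable section
open scoped Classical
open MulOpposite

universe u

namespace Toupie

/-- Vertices of a toupie quiver with `t` branches, branch `i` having length `ℓ i ≥ 1`:
the unique source `src`, the unique sink `snk`, and for each branch `i` its interior
vertices `mid i a` (the `(a+1)`-st vertex on branch `i`, for `a : Fin (ℓ i - 1)`). -/
inductive Vtx (t : ℕ) (ℓ : Fin t → ℕ) : Type
  | src : Vtx t ℓ
  | snk : Vtx t ℓ
  | mid (i : Fin t) (a : Fin (ℓ i - 1)) : Vtx t ℓ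

/-- The `a`-th vertex on branch `i`, for `0 ≤ a ≤ ℓ i`
(`a = 0` is the source, `a = ℓ i` is the sink). -/
def vtx (t : ℕ) (ℓ : Fin t → ℕ) (i : Fin t) (a : ℕ) : Vtx t ℓ :=
  if a = 0 then .src else if h : a - 1 < ℓ i - 1 then .mid i ⟨a - 1, h⟩ else .snk

/-- The paths of a toupie quiver: trivial paths at the vertices, and for each branch
`i` and `a < b ≤ ℓ i` the path `sub i a b` along branch `i` from its `a`-th vertex to
its `b`-th vertex.  (`sub i 0 (ℓ i)` is the `i`-th branch `w i`.) -/
inductive PIdx (t : ℕ) (ℓ : Fin t → ℕ) : Type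
  | vert (v : Vtx t ℓ) : PIdx t ℓ
  | sub (i : Fin t) (a b : ℕ) (hab : a < b) (hb : b ≤ ℓ i) : PIdx t ℓ

variable (k : Type u) [Field k] (t : ℕ) (ℓ : Fin t → ℕ)

/-- The vector space with basis the set of paths of the toupie quiver. -/
abbrev PSp : Type u := PIdx t ℓ → k

variable {t ℓ}

/-- The starting vertex of a path. -/
def startIdx : PIdx t ℓ → Vtx t ℓ
  | .vert v => v
  | .sub i a _ _ _ => vtx t ℓ i a

/-- Left multiplication by the trivial path (primitive idempotent) `e_v`. -/
def Ev (v : Vtx t ℓ) : Module.End k (PSp k t ℓ) where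
  toFun f := fun p => if startIdx p = v then f p else 0
  map_add' f g := by funext p; by_cases h : startIdx p = v <;> simp [h]
  map_smul' c f := by funext p; by_cases h : startIdx p = v <;> simp [h]

/-- Strip the `j`-th arrow of branch `i` (the arrow `vtx i j ⟶ vtx i (j+1)`) from the
front of a path, if possible. -/
def strip (i : Fin t) (j : ℕ) : PIdx t ℓ → Option (PIdx t ℓ)
  | .vert _ => none
  | .sub i' a b _ hb =>
      if h : i' = i ∧ a = j then
        if hb2 : j + 1 < b then some (.sub i (j + 1) b hb2 (h.1 ▸ hb))
        else some (.vert (vtx t ℓ i b))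
      else none

/-- Left multiplication by the `j`-th arrow of branch `i`
(the arrow from `vtx i j` to `vtx i (j+1)`, for `j < ℓ i`; the zero operator for junk `j`). -/
def Ar (i : Fin t) (j : ℕ) : Module.End k (PSp k t ℓ) where
  toFun f := fun p => (strip i j p).elim 0 f
  map_add' f g := by funext p; rcases h : strip i j p with _ | q <;> simp [h]
  map_smul' c f := by funext p; rcases h : strip i j p with _ | q <;> simp [h]

variable (t ℓ)

/-- The generators of the path algebra: the trivial paths and the arrows. -/
def gens : Set (Module.End k (PSp k t ℓ)) :=
  Set.range (Ev k) ∪ {x | ∃ i j, x = Ar k i j}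

/-- The path algebra `kQ` of the toupie quiver, realized as the subalgebra of
`Module.End k (PSp k t ℓ)` generated by left multiplication by trivial paths and arrows. -/
def PathAlg : Subalgebra k (Module.End k (PSp k t ℓ)) :=
  Algebra.adjoin k (gens k t ℓ)

variable {k t ℓ}

/-- The trivial path `e_v` as an element of the path algebra. -/
def eV (v : Vtx t ℓ) : PathAlg k t ℓ :=
  ⟨Ev k v, Algebra.subset_adjoin (Or.inl ⟨v, rfl⟩)⟩

/-- The `j`-th arrow of branch `i` as an element of the path algebra. -/
def arE (i : Fin t) (j : ℕ) : PathAlg k t ℓ :=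
  ⟨Ar k i j, Algebra.subset_adjoin (Or.inr ⟨i, j, rfl⟩)⟩

/-- The path along branch `i` from its `a`-th vertex to its `b`-th vertex, as an element
of the path algebra: the product (composed from left to right) of the arrows
`a → a+1 → ⋯ → b`.  (For `b ≤ a` this is the empty product `1`.) -/
def subE (i : Fin t) (a b : ℕ) : PathAlg k t ℓ :=
  (((List.range (b - a)).map fun s => arE i (a + s)).prod)

/-- The `i`-th branch `w i` (the path from the source to the sink along branch `i`)
as an element of the path algebra. -/
def wE (i : Fin t) : PathAlg k t ℓ := subE i 0 (ℓ i)

variable {k : Type u} [Field k]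

/-- A toupie algebra `A = kQ/I`: a toupie quiver `Q` (a non-linear quiver with a unique
source, a unique sink, and all other vertices having exactly one incoming and one
outgoing arrow, i.e. `t ≥ 2` branches of lengths `ℓ i ≥ 1`), together with an admissible
ideal `I` of the path algebra `kQ`.  Since `Q` is finite and acyclic, the arrow ideal is
nilpotent, so admissibility amounts to `I ⊆ R_Q²`, i.e. every element of `I` is a linear
combination of paths of length `≥ 2`. -/
structure ToupieAlg (k : Type u) [Field k] : Type u where
  t : ℕ
  ht : 2 ≤ t
  ℓ : Fin t → ℕ
  hℓ : ∀ i, 1 ≤ ℓ i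
  I : TwoSidedIdeal (PathAlg k t ℓ)
  adm : ∀ x ∈ I, x ∈ Submodule.span k
    {y : PathAlg k t ℓ | ∃ i a b, a + 2 ≤ b ∧ b ≤ ℓ i ∧ y = subE i a b}

variable (T : ToupieAlg k)

/-- The underlying algebra `A = kQ/I` of a toupie algebra. -/
def Alg : Type u := T.I.ringCon.Quotient

instance : Ring (Alg T) := inferInstanceAs (Ring T.I.ringCon.Quotient)

/-- The quotient map `kQ → A = kQ/I`. -/
def mkA : PathAlg k T.t T.ℓ →+* Alg T := T.I.ringCon.mk'

lemma mkA_surjective : Function.Surjective (mkA T) := Quotient.mk''_surjective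

instance : Algebra k (Alg T) :=
  RingHom.toAlgebra' ((mkA T).comp (algebraMap k (PathAlg k T.t T.ℓ)))
    (by
      intro c x
      obtain ⟨y, rfl⟩ := mkA_surjective T x
      simp only [RingHom.coe_comp, Function.comp_apply, ← map_mul]
      rw [Algebra.commutes])

/-- The idempotent `e₀` (at the source) in `A`. -/
def e0 : Alg T := mkA T (eV Vtx.src)

/-- The idempotent `e∞` (at the sink) in `A`. -/
def einf : Alg T := mkA T (eV Vtx.snk)

/-- The `k`-linear map `A → A`, `x ↦ e₀ * x * e∞`, whose range is `e₀ A e∞`. -/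
def lrMap : Alg T →ₗ[k] Alg T where
  toFun x := e0 T * x * einf T
  map_add' x y := by simp [mul_add, add_mul]
  map_smul' c x := by
    simp only [RingHom.id_apply]
    rw [mul_smul_comm, smul_mul_assoc]

/-- `m = dim_k e₀ A e∞`, the dimension of the span of the (residues of the) paths from
the source to the sink. -/
def mDim : ℕ := Module.finrank k ↥(LinearMap.range (lrMap T))

/-- The branch `w i` lies in the ideal `I`. -/
def branchInI (i : Fin T.t) : Prop := wE i ∈ T.I

/-- A minimal relation: `∑_{i ∈ J} λ i • w i ∈ I` with `|J| ≥ 2`, all `λ i ≠ 0`, and no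
nonempty proper subsum in `I`. -/
def MinRel (J : Finset (Fin T.t)) (lam : Fin T.t → k) : Prop :=
  2 ≤ J.card ∧ (∀ i ∈ J, lam i ≠ 0) ∧ (∑ i ∈ J, lam i • wE i) ∈ T.I ∧
    ∀ J' ⊂ J, J'.Nonempty → (∑ i ∈ J', lam i • wE i) ∉ T.I

/-- A toupie algebra is simply connected if any two distinct branches are involved in a
common minimal relation. -/
def SimplyConnected : Prop :=
  ∀ i j : Fin T.t, i ≠ j → ∃ J lam, MinRel T J lam ∧ i ∈ J ∧ j ∈ J

/-- A (minimal) zero-relation on branch `i`: the subpath of branch `i` from its `a`-th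
to its `b`-th vertex lies in `I`, but no proper subpath of it does. -/
def ZeroRel (i : Fin T.t) (a b : ℕ) : Prop :=
  a < b ∧ b ≤ T.ℓ i ∧ subE i a b ∈ T.I ∧
    ∀ a' b', a ≤ a' → b' ≤ b → a' < b' → (a', b') ≠ (a, b) → subE i a' b' ∉ T.I

/-- There is exactly one relation on branch `i`. -/
def ExactlyOneRel (i : Fin T.t) : Prop := ∃! p : ℕ × ℕ, ZeroRel T i p.1 p.2

/-- Branch `i` carries more than one relation. -/
def MoreThanOneRel (i : Fin T.t) : Prop :=
  ∃ p q : ℕ × ℕ, p ≠ q ∧ ZeroRel T i p.1 p.2 ∧ ZeroRel T i q.1 q.2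

/-- At most one branch of `Q` has length at least three. -/
def AtMostOneLongBranch : Prop := ∀ i j : Fin T.t, 3 ≤ T.ℓ i → 3 ≤ T.ℓ j → i = j

/-- The two-sided ideal `I` is generated by the set `S`. -/
def IsGenBy {R : Type u} [Ring R] (I : TwoSidedIdeal R) (S : Set R) : Prop :=
  S ⊆ (I : Set R) ∧ ∀ J : TwoSidedIdeal R, S ⊆ (J : Set R) → (I : Set R) ⊆ (J : Set R)

/-- A toupie algebra is canonical if (after choosing two distinguished branches `i₁, i₂`)
its ideal is generated by `{w i₁ + λ j • w i₂ - w j}` over the remaining branches `j`,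
with the `λ j` pairwise distinct and nonzero. -/
def IsCanonical : Prop :=
  ∃ (i₁ i₂ : Fin T.t) (lam : Fin T.t → k), i₁ ≠ i₂ ∧
    (∀ j, j ≠ i₁ → j ≠ i₂ → lam j ≠ 0) ∧
    (∀ j j', j ≠ i₁ → j ≠ i₂ → j' ≠ i₁ → j' ≠ i₂ → j ≠ j' → lam j ≠ lam j') ∧
    IsGenBy T.I {x | ∃ j, j ≠ i₁ ∧ j ≠ i₂ ∧ x = wE i₁ + lam j • wE i₂ - wE j}

end Toupie
namespace Toupie

/-! ### Module-theoretic notions over an arbitrary ring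

Following the paper, all modules are finite-dimensional *right* modules; a right
`A`-module is formalized as a (left) module over `Aᵐᵒᵖ`.  The definitions below are
stated for modules over an arbitrary ring `R` and are applied with `R := Aᵐᵒᵖ`. -/

variable (R : Type u) [Ring R]

/-- A module is indecomposable if it is nonzero and its only idempotent endomorphisms
are `0` and the identity. -/
def Indec (M : ModuleCat.{u} R) : Prop :=
  Nontrivial M ∧ ∀ f : M →ₗ[R] M, f.comp f = f → f = 0 ∨ f = LinearMap.id

/-- Finiteness ("finite dimensionality") of a module. -/
def FdMod (M : ModuleCat.{u} R) : Prop := Module.Finite R M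

/-- `M` has projective dimension at most one: it is the quotient of a projective module
by a projective submodule. -/
def PdLeOne (M : ModuleCat.{u} R) : Prop :=
  ∃ (P : ModuleCat.{u} R) (f : P →ₗ[R] M), Function.Surjective f ∧
    Module.Projective R P ∧ Module.Projective R ↥(LinearMap.ker f)

/-- `M` has injective dimension at most one: it embeds in an injective module with
injective cokernel. -/
def IdLeOne (M : ModuleCat.{u} R) : Prop :=
  ∃ (E : ModuleCat.{u} R) (f : M →ₗ[R] E), Function.Injective f ∧
    Module.Injective R E ∧ Module.Injective R (E ⧸ LinearMap.range f)

/-- One step of a path in `ind R`: a nonzero non-isomorphism between (finite-dimensional)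
indecomposable modules. -/
def Step (M N : ModuleCat.{u} R) : Prop :=
  Indec R M ∧ FdMod R M ∧ Indec R N ∧ FdMod R N ∧
    ∃ f : M →ₗ[R] N, f ≠ 0 ∧ ¬ Function.Bijective f

/-- A path in `ind R` from `M` to `N` (possibly trivial): a chain
`M = M₀ → M₁ → ⋯ → Mₙ = N` of nonzero non-isomorphisms between indecomposables. -/
def IndPath (M N : ModuleCat.{u} R) : Prop := Relation.ReflTransGen (Step R) M N

/-- The left part `L_R`: the indecomposable (finite-dimensional) modules `M` such that
every indecomposable `X` with a path `X ⇝ M` in `ind R` has projective dimension `≤ 1`. -/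
def InLeftPart (M : ModuleCat.{u} R) : Prop :=
  Indec R M ∧ FdMod R M ∧
    ∀ X : ModuleCat.{u} R, Indec R X → FdMod R X → IndPath R X M → PdLeOne R X

/-- The right part `R_R`: the indecomposable (finite-dimensional) modules `M` such that
every indecomposable `X` with a path `M ⇝ X` in `ind R` has injective dimension `≤ 1`. -/
def InRightPart (M : ModuleCat.{u} R) : Prop :=
  Indec R M ∧ FdMod R M ∧
    ∀ X : ModuleCat.{u} R, Indec R X → FdMod R X → IndPath R M X → IdLeOne R X

/-- Hereditary: global dimension at most one, i.e. every module has projective dimension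
at most one. -/
def Hereditary : Prop := ∀ M : ModuleCat.{u} R, PdLeOne R M

/-- Quasitilted: every indecomposable projective module lies in the left part. -/
def Quasitilted : Prop :=
  ∀ P : ModuleCat.{u} R, Indec R P → FdMod R P → Module.Projective R P → InLeftPart R P

/-- A module is directed if it lies on no cycle of nonzero non-isomorphisms between
indecomposables in `ind R`. -/
def Directed (M : ModuleCat.{u} R) : Prop := ¬ Relation.TransGen (Step R) M M

/-- Weakly shod: every indecomposable (finite-dimensional) module not lying in
`L_R ∪ R_R` is directed. -/
def WeaklyShod : Prop :=
  ∀ M : ModuleCat.{u} R, Indec R M → FdMod R M →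
    ¬ InLeftPart R M → ¬ InRightPart R M → Directed R M

/-- Laura: all but finitely many isomorphism classes of indecomposable
(finite-dimensional) modules lie in `L_R ∪ R_R`. -/
def Laura : Prop :=
  ∃ S : Set (ModuleCat.{u} R), S.Finite ∧
    ∀ M : ModuleCat.{u} R, Indec R M → FdMod R M →
      ¬ InLeftPart R M → ¬ InRightPart R M → ∃ N ∈ S, Nonempty (M ≃ₗ[R] N)

/-- There are exactly `n` isomorphism classes of modules satisfying `P`. -/
def NumClasses (P : ModuleCat.{u} R → Prop) (n : ℕ) : Prop :=
  ∃ f : Fin n → ModuleCat.{u} R, (∀ i, P (f i)) ∧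
    (∀ i j, Nonempty ((f i : Type u) ≃ₗ[R] (f j : Type u)) → i = j) ∧
    ∀ M : ModuleCat.{u} R, P M → ∃ i, Nonempty ((M : Type u) ≃ₗ[R] (f i : Type u))

/-- `M` is (isomorphic to) a direct summand of `T`. -/
def IsSummandOf (T : Type u) [AddCommGroup T] [Module R T] (M : ModuleCat.{u} R) : Prop :=
  ∃ N N' : Submodule R T, IsCompl N N' ∧ Nonempty ((M : Type u) ≃ₗ[R] N)

/-- `Ext¹_R(T, T) = 0`: every self-extension `0 → T → E → T → 0` splits. -/
def SelfExtVanish (T : Type u) [AddCommGroup T] [Module R T] : Prop :=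
  ∀ (E : Type u) [AddCommGroup E] [Module R E] (ι : T →ₗ[R] E) (π : E →ₗ[R] T),
    Function.Injective ι → Function.Surjective π → LinearMap.range ι = LinearMap.ker π →
      ∃ s : T →ₗ[R] E, π.comp s = LinearMap.id

/-- A tilting module over a hereditary algebra: a finite module with `Ext¹(T,T) = 0`
having as many pairwise non-isomorphic indecomposable direct summands as there are
simple modules. -/
def IsTiltingMod (T : Type u) [AddCommGroup T] [Module R T] : Prop :=
  Module.Finite R T ∧ SelfExtVanish R T ∧
    ∃ n : ℕ, NumClasses R (fun M => Indec R M ∧ IsSummandOf R T M) n ∧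
      NumClasses R (fun M => IsSimpleModule R M) n

variable (k : Type u) [Field k]

/-- A `k`-algebra `A` is tilted if it is the endomorphism algebra of a tilting (right)
module over a hereditary finite-dimensional `k`-algebra `H`.  (Right `H`-modules are
modules over `Hᵐᵒᵖ`; the isomorphism `A ≅ End_H T` is a `k`-linear ring isomorphism.) -/
def IsTilted (A : Type u) [Ring A] [Algebra k A] : Prop :=
  ∃ (H : Type u) (_ : Ring H) (_ : Algebra k H),
    FiniteDimensional k H ∧ Hereditary Hᵐᵒᵖ ∧
      ∃ (T : Type u) (_ : AddCommGroup T) (_ : Module Hᵐᵒᵖ T),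
        IsTiltingMod Hᵐᵒᵖ T ∧
          ∃ (_ : Module k T) (_ : SMulCommClass Hᵐᵒᵖ k T) (_ : IsScalarTower k Hᵐᵒᵖ T)
            (φ : A ≃+* Module.End Hᵐᵒᵖ T), ∀ (c : k) (x : A), φ (c • x) = c • φ x

end Toupie
namespace Toupie

variable {k : Type u} [Field k] (T : ToupieAlg k)

/-! ### Right `A`-modules as representations of `(Q, I)`

For a right `A`-module `M` (a module over `Aᵐᵒᵖ`) and a vertex `v`, the space of the
corresponding representation at `v` is `M_v = M • e_v`. -/

/-- The action of the idempotent `e_v ∈ A` on a right `A`-module (= `Aᵐᵒᵖ`-module). -/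
def actV (v : Vtx T.t T.ℓ) : (Alg T)ᵐᵒᵖ := op (mkA T (eV v))

/-- The space `M_v = M • e_v` of the representation `M` at the vertex `v` is zero. -/
def VanishAt (M : ModuleCat.{u} (Alg T)ᵐᵒᵖ) (v : Vtx T.t T.ℓ) : Prop :=
  ∀ m : M, actV T v • m = 0

/-- Every simple summand of `top M = M / rad M` is one of the simple modules `S_v`,
`v ∈ vs`: for every maximal submodule `N` the simple quotient `M/N` is supported at some
vertex of `vs` (for an admissible quotient of a path algebra, the simple module `S_v` is
the unique simple on which `e_v` acts nontrivially). -/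
def TopIn (M : ModuleCat.{u} (Alg T)ᵐᵒᵖ) (vs : Set (Vtx T.t T.ℓ)) : Prop :=
  ∀ N : Submodule (Alg T)ᵐᵒᵖ M, IsCoatom N → ∃ v ∈ vs, ∃ m : M, actV T v • m ∉ N

/-- Every simple summand of the socle of `M` is one of the simple modules `S_v`,
`v ∈ vs`: every simple submodule `N ≤ M` is supported at some vertex of `vs`. -/
def SocIn (M : ModuleCat.{u} (Alg T)ᵐᵒᵖ) (vs : Set (Vtx T.t T.ℓ)) : Prop :=
  ∀ N : Submodule (Alg T)ᵐᵒᵖ M, IsAtom N → ∃ v ∈ vs, ∃ m ∈ N, actV T v • m ≠ 0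

/-- The module `D x y` (for two positions `0 ≤ x, y ≤ ℓ i₀` on the unique branch `i₀`
lying in `I`, and an auxiliary branch `i₂ ≠ i₀`): the right `A`-module with generators
`g = e₀` (at the source) and `h = e_y` (at the `y`-th vertex of branch `i₀`), subject to
the relations `g ⬝ (subpath of w i₀ from 0 to x+1) = 0` and
`g ⬝ w i₂ = h ⬝ (subpath of w i₀ from y to ℓ i₀)`.  It is presented as the quotient of
the right regular module `A ⊕ A` by the right submodule generated by
`(1 - e₀, 0)`, `(0, 1 - e_y)`, `(subE i₀ 0 (min (x+1) (ℓ i₀)), 0)` and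
`(w i₂, - subE i₀ y (ℓ i₀))`. -/
abbrev Dmod (i₀ i₂ : Fin T.t) (x y : ℕ) : Type u :=
  (Alg T × Alg T) ⧸ Submodule.span (Alg T)ᵐᵒᵖ
    ({((mkA T (1 - eV Vtx.src) : Alg T), (0 : Alg T)),
      ((0 : Alg T), (mkA T (1 - eV (vtx T.t T.ℓ i₀ y)) : Alg T)),
      ((mkA T (subE i₀ 0 (min (x + 1) (T.ℓ i₀))) : Alg T), (0 : Alg T)),
      ((mkA T (wE i₂) : Alg T), (- mkA T (subE i₀ y (T.ℓ i₀)) : Alg T))} :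
        Set (Alg T × Alg T))

end Toupie

namespace Toupie

/-! ### Vanishing of extensions -/

section Extensions

variable {R : Type u} [Ring R]

/-- `Ext¹(W, J) = 0`: every map to `J` from the kernel of a surjection onto `W` extends. -/
def ExtVanish (R : Type u) [Ring R] (W J : Type u) [AddCommGroup W] [Module R W]
    [AddCommGroup J] [Module R J] : Prop :=
  ∀ (E : Type u) [AddCommGroup E] [Module R E] (π : E →ₗ[R] W), Function.Surjective π →
    ∀ φ : LinearMap.ker π →ₗ[R] J, ∃ ψ : E →ₗ[R] J, ∀ x : LinearMap.ker π, ψ x = φ x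

variable {M N P : Type u} [AddCommGroup M] [Module R M] [AddCommGroup N] [Module R N]
  [AddCommGroup P] [Module R P]

lemma exists_factor_of_surjective (π : M →ₗ[R] N) (hπ : Function.Surjective π) (g : M →ₗ[R] P)
    (h : LinearMap.ker π ≤ LinearMap.ker g) : ∃ q : N →ₗ[R] P, ∀ x, q (π x) = g x := by
  refine ⟨((LinearMap.ker π).liftQ g h).comp
    (LinearMap.quotKerEquivOfSurjective π hπ).symm.toLinearMap, fun x => ?_⟩
  have : (LinearMap.quotKerEquivOfSurjective π hπ).symm (π x) = (LinearMap.ker π).mkQ x := by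
    rw [LinearEquiv.symm_apply_eq]; rfl
  simp [this]

lemma exists_factor_of_injective (i : N →ₗ[R] P) (hi : Function.Injective i) (g : M →ₗ[R] P)
    (h : LinearMap.range g ≤ LinearMap.range i) : ∃ q : M →ₗ[R] N, ∀ x, i (q x) = g x := by
  refine ⟨(LinearEquiv.ofInjective i hi).symm.toLinearMap.comp
    (g.codRestrict (LinearMap.range i) fun x => h ⟨x, rfl⟩), fun x => ?_⟩
  have := (LinearEquiv.ofInjective i hi).apply_symm_apply
    (g.codRestrict (LinearMap.range i) (fun x => h ⟨x, rfl⟩) x)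
  exact congrArg Subtype.val this

lemma extVanish_of_subsingleton_left [Subsingleton M] : ExtVanish R M N := by
  intro E _ _ π _ φ
  have h : ∀ x, x ∈ LinearMap.ker π := fun x => Subsingleton.elim _ _
  exact ⟨φ.comp (LinearMap.codRestrict _ LinearMap.id h), fun x => rfl⟩

lemma extVanish_of_subsingleton_right [Subsingleton N] : ExtVanish R M N := by
  intro E _ _ π _ φ
  exact ⟨0, fun x => Subsingleton.elim _ _⟩

lemma extVanish_of_injective [Module.Injective R N] : ExtVanish R M N := by
  intro E _ _ π _ φ
  exact Module.Injective.out (LinearMap.ker π).subtype Subtype.val_injective φ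

/-- A retraction of the kernel can be transported along any presentation of the same module. -/
lemma ExtVanish.exists_of_exact (h : ExtVanish R M N) {E K : Type u} [AddCommGroup E] [Module R E]
    [AddCommGroup K] [Module R K] (ι : K →ₗ[R] E) (π : E →ₗ[R] M) (hι : Function.Injective ι)
    (hπ : Function.Surjective π) (he : LinearMap.range ι = LinearMap.ker π) (φ : K →ₗ[R] N) :
    ∃ ψ : E →ₗ[R] N, ∀ x, ψ (ι x) = φ x := by
  obtain ⟨q, hq⟩ := exists_factor_of_injective ι hι (LinearMap.ker π).subtype (by simp [he])
  obtain ⟨ψ, hψ⟩ := h E π hπ (φ.comp q)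
  refine ⟨ψ, fun x => ?_⟩
  have hx : ι x ∈ LinearMap.ker π := he ▸ ⟨x, rfl⟩
  have := hψ ⟨ι x, hx⟩
  simp only [LinearMap.comp_apply] at this
  rw [this]
  congr 1
  exact hι (hq ⟨ι x, hx⟩)

lemma ExtVanish.prod_left (h₁ : ExtVanish R M P) (h₂ : ExtVanish R N P) :
    ExtVanish R (M × N) P := by
  intro E _ _ π hπ φ
  let π₁ := (LinearMap.fst R M N).comp π
  let π₂ : LinearMap.ker π₁ →ₗ[R] N := (LinearMap.snd R M N).comp (π.comp (Submodule.subtype _))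
  have hle : LinearMap.ker π ≤ LinearMap.ker π₁ := fun x hx => by
    simp_all [π₁]
  obtain ⟨ψ, hψ⟩ := h₂.exists_of_exact (Submodule.inclusion hle) π₂
    (Submodule.inclusion_injective hle) (fun n => by
      obtain ⟨x, hx⟩ := hπ (0, n)
      exact ⟨⟨x, by simp [π₁, hx]⟩, by simp [π₂, hx]⟩) (by
      ext ⟨x, hx⟩
      simp only [π₁, LinearMap.mem_ker, LinearMap.comp_apply, LinearMap.fst_apply] at hx
      simp [Submodule.range_inclusion, π₂, Prod.ext_iff, hx]) φ
  obtain ⟨χ, hχ⟩ := h₁ E π₁ (fun m => by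
    obtain ⟨x, hx⟩ := hπ (m, 0)
    exact ⟨x, by simp [π₁, hx]⟩) ψ
  exact ⟨χ, fun x => (hχ (Submodule.inclusion hle x)).trans (hψ x)⟩

lemma ExtVanish.prod_right (h₁ : ExtVanish R P M) (h₂ : ExtVanish R P N) :
    ExtVanish R P (M × N) := by
  intro E _ _ π hπ φ
  obtain ⟨ψ₁, hψ₁⟩ := h₁ E π hπ ((LinearMap.fst R M N).comp φ)
  obtain ⟨ψ₂, hψ₂⟩ := h₂ E π hπ ((LinearMap.snd R M N).comp φ)
  exact ⟨ψ₁.prod ψ₂, fun x => by ext <;> simp [hψ₁, hψ₂]⟩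

lemma ExtVanish.of_projective_presentation {Q : Type u} [AddCommGroup Q] [Module R Q]
    [Module.Projective R Q] (f : Q →ₗ[R] M) (hf : Function.Surjective f)
    (h : ∀ φ : LinearMap.ker f →ₗ[R] N, ∃ ψ : Q →ₗ[R] N, ∀ x : LinearMap.ker f, ψ x = φ x) :
    ExtVanish R M N := by
  intro E _ _ π hπ φ
  obtain ⟨s, hs⟩ := Module.projective_lifting_property π f hπ
  have hs' : ∀ x, π (s x) = f x := fun x => LinearMap.congr_fun hs x
  obtain ⟨χ, hχ⟩ := h (φ.comp ((s.comp (LinearMap.ker f).subtype).codRestrict (LinearMap.ker π)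
    (fun x => by simp [hs'])))
  obtain ⟨ψ, hψ⟩ := exists_factor_of_surjective
    ((LinearMap.ker π).subtype.coprod s) (fun e => by
      obtain ⟨p, hp⟩ := hf (π e)
      exact ⟨(⟨e - s p, by simp [hs', hp]⟩, p), by simp⟩) (φ.coprod χ) (by
      rintro ⟨x, p⟩ hx
      rw [LinearMap.mem_ker, LinearMap.coprod_apply, Submodule.subtype_apply,
        add_eq_zero_iff_eq_neg'] at hx
      have hp : f p = 0 := by rw [← hs', hx, map_neg, x.2, neg_zero]
      rw [LinearMap.mem_ker, LinearMap.coprod_apply, hχ ⟨p, hp⟩, LinearMap.comp_apply, ← map_add]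
      convert map_zero φ
      exact Subtype.ext (add_eq_zero_iff_eq_neg'.2 hx))
  exact ⟨ψ, fun x => by simpa using hψ (x, 0)⟩

lemma ExtVanish.of_surjective (hM : PdLeOne R (ModuleCat.of R M)) (h : ExtVanish R M N)
    (g : N →ₗ[R] P) (hg : Function.Surjective g) : ExtVanish R M P := by
  obtain ⟨Q, f, hf, hQ, hK⟩ := hM
  refine ExtVanish.of_projective_presentation (Q := Q) f hf fun φ => ?_
  obtain ⟨φ', hφ'⟩ := Module.projective_lifting_property g φ hg
  obtain ⟨ψ, hψ⟩ := h Q f hf φ'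
  exact ⟨g.comp ψ, fun x => by
    rw [LinearMap.comp_apply, hψ]; exact LinearMap.congr_fun hφ' x⟩

lemma ExtVanish.of_injective (hN : IdLeOne R (ModuleCat.of R N)) (h : ExtVanish R M N)
    (g : P →ₗ[R] M) (hg : Function.Injective g) : ExtVanish R P N := by
  obtain ⟨I, f, hf, hI, hC⟩ := hN
  change N →ₗ[R] I at f
  intro E _ _ π hπ φ
  obtain ⟨Φ, hΦ⟩ := Module.Injective.out (LinearMap.ker π).subtype Subtype.val_injective
    (f.comp φ)
  let q := (LinearMap.range f).mkQ
  obtain ⟨β, hβ⟩ := exists_factor_of_surjective π hπ (q.comp Φ) (fun x hx => by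
    have := hΦ ⟨x, hx⟩
    simp only [Submodule.subtype_apply] at this
    simp [q, this])
  obtain ⟨α, hα⟩ := Module.Injective.out g hg β
  let δ : I × M →ₗ[R] (I ⧸ LinearMap.range f) :=
    q.comp (LinearMap.fst R I M) - α.comp (LinearMap.snd R I M)
  obtain ⟨ρ, hρ⟩ := h.exists_of_exact
    (((LinearMap.inl R I M).comp f).codRestrict (LinearMap.ker δ) (fun x => by simp [δ, q]))
    ((LinearMap.snd R I M).comp (LinearMap.ker δ).subtype)
    (fun x y hxy => by
      have := congrArg (fun z : LinearMap.ker δ => (z : I × M).1) hxy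
      exact hf this)
    (fun m => by
      obtain ⟨x, hx⟩ := (LinearMap.range f).mkQ_surjective (α m)
      exact ⟨⟨(x, m), by simp [δ, q, ← hx]⟩, rfl⟩)
    (by
      ext ⟨⟨x, m⟩, hx⟩
      simp only [δ, q, LinearMap.mem_ker, LinearMap.sub_apply, LinearMap.comp_apply,
        LinearMap.fst_apply, LinearMap.snd_apply] at hx
      constructor
      · rintro ⟨y, hy⟩
        have := congrArg (fun z : LinearMap.ker δ => (z : I × M).2) hy
        exact this.symm
      · intro hm
        have hm : m = 0 := hm
        subst hm
        rw [map_zero, sub_zero, Submodule.mkQ_apply, Submodule.Quotient.mk_eq_zero] at hx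
        obtain ⟨y, hy⟩ := hx
        exact ⟨y, Subtype.ext (Prod.ext hy rfl)⟩)
    LinearMap.id
  refine ⟨ρ.comp ((Φ.prod (g.comp π)).codRestrict (LinearMap.ker δ)
    (fun x => by simp [δ, hα, hβ])), fun x => ?_⟩
  have := hρ (φ x)
  rw [LinearMap.id_apply] at this
  rw [← this, LinearMap.comp_apply]
  congr 1
  refine Subtype.ext (Prod.ext (hΦ x) ?_)
  change g (π x) = 0
  simp

lemma extVanish_of_split
    (h : ∀ (E : Type u) [AddCommGroup E] [Module R E] (ι : N →ₗ[R] E) (π : E →ₗ[R] M),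
      Function.Injective ι → Function.Surjective π → LinearMap.range ι = LinearMap.ker π →
        ∃ ρ : E →ₗ[R] N, ∀ x, ρ (ι x) = x) : ExtVanish R M N := by
  intro E _ _ π hπ φ
  let d : LinearMap.ker π →ₗ[R] N × E := φ.prod (-(LinearMap.ker π).subtype)
  let q := (LinearMap.range d).mkQ
  have hd : LinearMap.range d ≤ LinearMap.ker (π.comp (LinearMap.snd R N E)) := by
    rintro _ ⟨x, rfl⟩
    simp [d]
  obtain ⟨ρ, hρ⟩ := h ((N × E) ⧸ LinearMap.range d) (q.comp (LinearMap.inl R N E))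
    ((LinearMap.range d).liftQ (π.comp (LinearMap.snd R N E)) hd)
    (by
      rw [injective_iff_map_eq_zero]
      intro n hn
      rw [LinearMap.comp_apply, Submodule.mkQ_apply, Submodule.Quotient.mk_eq_zero] at hn
      obtain ⟨x, hx⟩ := hn
      have h₁ : φ x = n := congrArg Prod.fst hx
      have h₂ : -(x : E) = 0 := congrArg Prod.snd hx
      rw [neg_eq_zero, ZeroMemClass.coe_eq_zero] at h₂
      rw [← h₁, h₂, map_zero])
    (fun m => by
      obtain ⟨x, hx⟩ := hπ m
      exact ⟨q (0, x), by simp [q, hx]⟩)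
    (by
      ext z
      obtain ⟨⟨n, x⟩, rfl⟩ := (LinearMap.range d).mkQ_surjective z
      constructor
      · rintro ⟨y, hy⟩
        rw [← hy]; simp [q]
      · intro hx
        have hx : π x = 0 := hx
        refine ⟨n + φ ⟨x, hx⟩, ?_⟩
        rw [LinearMap.comp_apply, ← sub_eq_zero, ← map_sub, Submodule.mkQ_apply,
          Submodule.Quotient.mk_eq_zero]
        exact ⟨⟨x, hx⟩, by simp [d]⟩)
  refine ⟨(ρ.comp q).comp (LinearMap.inr R N E), fun x => ?_⟩
  rw [← hρ (φ x)]
  simp only [LinearMap.comp_apply]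
  congr 1
  rw [eq_comm, ← sub_eq_zero, ← map_sub, Submodule.mkQ_apply, Submodule.Quotient.mk_eq_zero]
  exact ⟨x, by simp [d]⟩

end Extensions

end Toupie

namespace Toupie

/-! ### Cycles in the left and right parts -/

section Cycles

variable {R : Type u} [Ring R]

/-- There is a nonzero map between the finite indecomposable modules `M` and `N`. -/
def Linked (M N : ModuleCat.{u} R) : Prop :=
  Indec R M ∧ FdMod R M ∧ Indec R N ∧ FdMod R N ∧ ∃ f : M →ₗ[R] N, f ≠ 0

lemma Step.linked {M N : ModuleCat.{u} R} (h : Step R M N) : Linked M N := by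
  obtain ⟨h₁, h₂, h₃, h₄, f, hf, -⟩ := h
  exact ⟨h₁, h₂, h₃, h₄, f, hf⟩

lemma Step.comp_equiv {M N P : ModuleCat.{u} R} (h : Step R M N) (hP : Indec R P)
    (hP' : FdMod R P) (e : N ≃ₗ[R] P) : Step R M P := by
  obtain ⟨h₁, h₂, -, -, f, hf, hf'⟩ := h
  refine ⟨h₁, h₂, hP, hP', e.toLinearMap.comp f, fun h => hf ?_, fun h => hf' ?_⟩
  · ext x; simpa using LinearMap.congr_fun h x
  · rw [LinearMap.coe_comp] at h
    exact (Function.Bijective.of_comp_iff' e.bijective f).1 h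

lemma transGen_step_linked {M N P : ModuleCat.{u} R} (h : Relation.TransGen (Step R) M N)
    (hl : Linked N P) : Relation.TransGen (Step R) M P := by
  obtain ⟨h₁, h₂, h₃, h₄, g, hg⟩ := hl
  by_cases hb : Function.Bijective g
  · cases h with
    | single h => exact .single (h.comp_equiv h₃ h₄ (LinearEquiv.ofBijective g hb))
    | tail h h' => exact .tail h (h'.comp_equiv h₃ h₄ (LinearEquiv.ofBijective g hb))
  · exact .tail h ⟨h₁, h₂, h₃, h₄, g, hg, hb⟩

lemma transGen_step_linked_chain {M N P : ModuleCat.{u} R} (h : Relation.TransGen (Step R) M N)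
    (hl : Relation.ReflTransGen Linked N P) : Relation.TransGen (Step R) M P := by
  induction hl with
  | refl => exact h
  | tail _ hl ih => exact transGen_step_linked ih hl

lemma PdLeOne.of_equiv {M N : ModuleCat.{u} R} (h : PdLeOne R M) (e : M ≃ₗ[R] N) :
    PdLeOne R N := by
  obtain ⟨P, f, hf, hP, hK⟩ := h
  refine ⟨P, e.toLinearMap.comp f, e.surjective.comp hf, hP, ?_⟩
  rwa [LinearEquiv.ker_comp]

lemma IdLeOne.of_equiv {M N : ModuleCat.{u} R} (h : IdLeOne R M) (e : M ≃ₗ[R] N) :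
    IdLeOne R N := by
  obtain ⟨I, f, hf, hI, hC⟩ := h
  refine ⟨I, f.comp e.symm.toLinearMap, hf.comp e.symm.injective, hI, ?_⟩
  rwa [LinearMap.range_comp_of_range_eq_top _ (LinearEquiv.range _)]

lemma InLeftPart.of_linked {M N : ModuleCat.{u} R} (hN : InLeftPart R N) (h : Linked M N) :
    InLeftPart R M := by
  obtain ⟨h₁, h₂, h₃, h₄, f, hf⟩ := h
  refine ⟨h₁, h₂, fun X hX hX' hp => ?_⟩
  by_cases hb : Function.Bijective f
  · cases hp with
    | refl => exact (hN.2.2 N h₃ h₄ .refl).of_equiv (LinearEquiv.ofBijective f hb).symm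
    | tail hp h' =>
      exact hN.2.2 X hX hX' (hp.tail (h'.comp_equiv h₃ h₄ (LinearEquiv.ofBijective f hb)))
  · exact hN.2.2 X hX hX' (hp.tail ⟨h₁, h₂, h₃, h₄, f, hf, hb⟩)

lemma Step.equiv_comp {M N P : ModuleCat.{u} R} (h : Step R M N) (hP : Indec R P)
    (hP' : FdMod R P) (e : P ≃ₗ[R] M) : Step R P N := by
  obtain ⟨-, -, h₁, h₂, f, hf, hf'⟩ := h
  refine ⟨hP, hP', h₁, h₂, f.comp e.toLinearMap, fun h => hf ?_, fun h => hf' ?_⟩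
  · ext x; simpa using LinearMap.congr_fun h (e.symm x)
  · rw [LinearMap.coe_comp] at h
    exact (Function.Bijective.of_comp_iff f e.bijective).1 h

lemma InRightPart.of_linked {M N : ModuleCat.{u} R} (hM : InRightPart R M) (h : Linked M N) :
    InRightPart R N := by
  obtain ⟨h₁, h₂, h₃, h₄, f, hf⟩ := h
  refine ⟨h₃, h₄, fun X hX hX' hp => ?_⟩
  by_cases hb : Function.Bijective f
  · rcases Relation.ReflTransGen.cases_head hp with rfl | ⟨Z, h', hp⟩
    · exact (hM.2.2 M h₁ h₂ .refl).of_equiv (LinearEquiv.ofBijective f hb)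
    · exact hM.2.2 X hX hX' (hp.head (h'.equiv_comp h₁ h₂ (LinearEquiv.ofBijective f hb)))
  · exact hM.2.2 X hX hX' (hp.head ⟨h₁, h₂, h₃, h₄, f, hf, hb⟩)

lemma linked_chain_transGen_step {M N P : ModuleCat.{u} R}
    (hl : Relation.ReflTransGen Linked M N) (h : Relation.TransGen (Step R) N P) :
    Relation.TransGen (Step R) M P := by
  induction hl using Relation.ReflTransGen.head_induction_on with
  | refl => exact h
  | head hl _ ih =>
    obtain ⟨h₁, h₂, h₃, h₄, g, hg⟩ := hl
    by_cases hb : Function.Bijective g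
    · obtain ⟨Z, hs, hZ⟩ := Relation.TransGen.head'_iff.1 ih
      exact .head' (hs.equiv_comp h₁ h₂ (LinearEquiv.ofBijective g hb)) hZ
    · exact .head ⟨h₁, h₂, h₃, h₄, g, hg, hb⟩ ih

lemma InLeftPart.pdLeOne {M : ModuleCat.{u} R} (h : InLeftPart R M) : PdLeOne R M :=
  h.2.2 M h.1 h.2.1 .refl

lemma InRightPart.idLeOne {M : ModuleCat.{u} R} (h : InRightPart R M) : IdLeOne R M :=
  h.2.2 M h.1 h.2.1 .refl

lemma bijective_of_bijective_comp {M N P : ModuleCat.{u} R} (hN : Indec R N) (hM : Indec R M)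
    {f : M →ₗ[R] N} {g : N →ₗ[R] P} (h : Function.Bijective (g.comp f)) :
    Function.Bijective g := by
  let e := LinearEquiv.ofBijective (g.comp f) h
  have he : ∀ x, g (f (e.symm x)) = x := fun x => e.apply_symm_apply x
  have hM' := hM.1
  have hsurj : Function.Surjective g := fun x => ⟨_, he x⟩
  rcases hN.2 (f.comp (e.symm.toLinearMap.comp g)) (by ext x; simp [he]) with h0 | h1
  · exfalso
    obtain ⟨x, hx⟩ := exists_ne (0 : M)
    have h2 : g (f x) = 0 := by
      rw [← he (g (f x))]
      have := LinearMap.congr_fun h0 (f x)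
      simp only [LinearMap.comp_apply, LinearEquiv.coe_coe, LinearMap.zero_apply] at this
      rw [this, map_zero]
    exact hx (h.1 (by simpa using h2))
  · refine ⟨fun x y hxy => ?_, hsurj⟩
    have hx := LinearMap.congr_fun h1 x
    have hy := LinearMap.congr_fun h1 y
    simp only [LinearMap.comp_apply, LinearMap.id_apply, hxy] at hx hy
    exact hx.symm.trans hy

lemma InLeftPart.of_indPath {M N : ModuleCat.{u} R} (hN : InLeftPart R N)
    (h : IndPath R M N) : InLeftPart R M := by
  induction h using Relation.ReflTransGen.head_induction_on with
  | refl => exact hN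
  | head h _ ih => exact ih.of_linked h.linked

lemma InRightPart.of_indPath {M N : ModuleCat.{u} R} (hM : InRightPart R M)
    (h : IndPath R M N) : InRightPart R N := by
  induction h with
  | refl => exact hM
  | tail _ h ih => exact ih.of_linked h.linked

variable [IsNoetherianRing R] [IsArtinianRing R]

/-- Modules of finite length are built from indecomposable ones by finite direct sums. -/
lemma fd_induction {motive : ∀ (F : Type u) [AddCommGroup F] [Module R F], Prop}
    (zero : ∀ (F : Type u) [AddCommGroup F] [Module R F], Subsingleton F → motive F)
    (indec : ∀ (F : Type u) [AddCommGroup F] [Module R F],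
      Indec R (ModuleCat.of R F) → FdMod R (ModuleCat.of R F) → motive F)
    (prod : ∀ (F F₁ F₂ : Type u) [AddCommGroup F] [Module R F] [AddCommGroup F₁] [Module R F₁]
      [AddCommGroup F₂] [Module R F₂], (F ≃ₗ[R] F₁ × F₂) → motive F₁ → motive F₂ → motive F)
    (F : Type u) [AddCommGroup F] [Module R F] [Module.Finite R F] : motive F := by
  induction hn : Module.length R F using WellFoundedLT.induction generalizing F with
  | ind n ih =>
  by_cases h0 : Subsingleton F
  · exact zero F h0
  by_cases hi : Indec R (ModuleCat.of R F)
  · exact indec F hi ‹_›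
  have h0' : Nontrivial F := not_subsingleton_iff_nontrivial.1 h0
  obtain ⟨f, hf, hf0, hf1⟩ : ∃ f : F →ₗ[R] F, f.comp f = f ∧ f ≠ 0 ∧ f ≠ LinearMap.id := by
    by_contra! hc
    exact hi ⟨h0', fun f hf => or_iff_not_imp_left.2 (hc f hf)⟩
  have hc := LinearMap.IsIdempotentElem.isCompl (f := f) hf
  refine prod F (LinearMap.range f) (LinearMap.ker f)
    (Submodule.prodEquivOfIsCompl _ _ hc).symm (ih _ ?_ _ rfl) (ih _ ?_ _ rfl)
  · rw [← hn]
    refine Submodule.length_lt fun h => hf1 ?_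
    ext x
    obtain ⟨y, rfl⟩ := LinearMap.range_eq_top.1 h x
    exact LinearMap.congr_fun hf y
  · rw [← hn]
    exact Submodule.length_lt fun h => hf0 (LinearMap.ker_eq_top.1 h)

lemma exists_split_of_map_to {Z J : Type u} [AddCommGroup Z] [Module R Z]
    [AddCommGroup J] [Module R J]
    (hJ : ∀ W : ModuleCat.{u} R, Indec R W → FdMod R W → (∃ g : W →ₗ[R] Z, g ≠ 0) →
      ExtVanish R W J)
    (F : Type u) [AddCommGroup F] [Module R F] [Module.Finite R F] : ∀ p : F →ₗ[R] Z,
      ∃ (W₁ W₂ : ModuleCat.{u} R) (e : F ≃ₗ[R] W₁ × W₂),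
        (∀ w, p (e.symm (0, w)) = 0) ∧ ExtVanish R W₁ J := by
  refine fd_induction (motive := fun (F : Type u) [AddCommGroup F] [Module R F] => ∀ p : F →ₗ[R] Z,
      ∃ (W₁ W₂ : ModuleCat.{u} R) (e : F ≃ₗ[R] W₁ × W₂),
        (∀ w, p (e.symm (0, w)) = 0) ∧ ExtVanish R W₁ J) ?_ ?_ ?_ F
  · intro F _ _ h0 p
    refine ⟨ModuleCat.of R F, ModuleCat.of R PUnit, LinearEquiv.prodUnique.symm, fun w => ?_,
      extVanish_of_subsingleton_left⟩
    rw [Subsingleton.elim (LinearEquiv.symm _ _) (0 : F), map_zero]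
  · intro F _ _ hF hF' p
    by_cases hp : p = 0
    · exact ⟨ModuleCat.of R PUnit, ModuleCat.of R F, LinearEquiv.uniqueProd.symm,
        fun w => by simp [hp], extVanish_of_subsingleton_left⟩
    · refine ⟨ModuleCat.of R F, ModuleCat.of R PUnit, LinearEquiv.prodUnique.symm,
        fun w => ?_, hJ _ hF hF' ⟨p, hp⟩⟩
      exact map_zero p
  · intro F F₁ F₂ _ _ _ _ _ _ e h₁ h₂ p
    obtain ⟨A₁, B₁, e₁, hp₁, hE₁⟩ := h₁ (p.comp (e.symm.toLinearMap.comp (LinearMap.inl R F₁ F₂)))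
    obtain ⟨A₂, B₂, e₂, hp₂, hE₂⟩ := h₂ (p.comp (e.symm.toLinearMap.comp (LinearMap.inr R F₁ F₂)))
    refine ⟨ModuleCat.of R (A₁ × A₂), ModuleCat.of R (B₁ × B₂),
      e.trans ((e₁.prodCongr e₂).trans (LinearEquiv.prodProdProdComm R A₁ B₁ A₂ B₂)),
      fun w => ?_, hE₁.prod_left hE₂⟩
    have h₁ := hp₁ w.1
    have h₂ := hp₂ w.2
    have := congrArg₂ (· + ·) h₁ h₂
    simp only [LinearMap.comp_apply, ← map_add, add_zero] at this
    rw [← this]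
    refine congrArg p (congrArg e.symm ?_)
    ext
    · simp
    · simp

lemma exists_split_of_map_from {Z J : Type u} [AddCommGroup Z] [Module R Z]
    [AddCommGroup J] [Module R J]
    (hJ : ∀ W : ModuleCat.{u} R, Indec R W → FdMod R W → (∃ g : Z →ₗ[R] W, g ≠ 0) →
      ExtVanish R J W)
    (F : Type u) [AddCommGroup F] [Module R F] [Module.Finite R F] : ∀ i : Z →ₗ[R] F,
      ∃ (W₁ W₂ : ModuleCat.{u} R) (e : F ≃ₗ[R] W₁ × W₂),
        (∀ z, (e (i z)).2 = 0) ∧ ExtVanish R J W₁ := by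
  refine fd_induction (motive := fun (F : Type u) [AddCommGroup F] [Module R F] => ∀ i : Z →ₗ[R] F,
      ∃ (W₁ W₂ : ModuleCat.{u} R) (e : F ≃ₗ[R] W₁ × W₂),
        (∀ z, (e (i z)).2 = 0) ∧ ExtVanish R J W₁) ?_ ?_ ?_ F
  · intro F _ _ h0 p
    exact ⟨ModuleCat.of R F, ModuleCat.of R PUnit, LinearEquiv.prodUnique.symm,
      fun w => Subsingleton.elim _ _, extVanish_of_subsingleton_right⟩
  · intro F _ _ hF hF' i
    by_cases hi : i = 0
    · exact ⟨ModuleCat.of R PUnit, ModuleCat.of R F, LinearEquiv.uniqueProd.symm,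
        fun w => by simp [hi], extVanish_of_subsingleton_right⟩
    · exact ⟨ModuleCat.of R F, ModuleCat.of R PUnit, LinearEquiv.prodUnique.symm,
        fun w => Subsingleton.elim _ _, hJ _ hF hF' ⟨i, hi⟩⟩
  · intro F F₁ F₂ _ _ _ _ _ _ e h₁ h₂ i
    obtain ⟨A₁, B₁, e₁, hp₁, hE₁⟩ := h₁ ((LinearMap.fst R F₁ F₂).comp (e.toLinearMap.comp i))
    obtain ⟨A₂, B₂, e₂, hp₂, hE₂⟩ := h₂ ((LinearMap.snd R F₁ F₂).comp (e.toLinearMap.comp i))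
    exact ⟨ModuleCat.of R (A₁ × A₂), ModuleCat.of R (B₁ × B₂),
      e.trans ((e₁.prodCongr e₂).trans (LinearEquiv.prodProdProdComm R A₁ B₁ A₂ B₂)),
      fun z => Prod.ext (hp₁ z) (hp₂ z), hE₁.prod_right hE₂⟩

end Cycles

end Toupie

namespace Toupie

section DirectedCycles

variable {R : Type u} [Ring R] [IsNoetherianRing R]

lemma finite_of_exact {K E C : Type u} [AddCommGroup K] [Module R K] [AddCommGroup E] [Module R E]
    [AddCommGroup C] [Module R C] (ι : K →ₗ[R] E) (π : E →ₗ[R] C)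
    (h : LinearMap.range ι = LinearMap.ker π) (hK : Module.Finite R K) (hC : Module.Finite R C) :
    Module.Finite R E := by
  have := isNoetherian_of_range_eq_ker ι π h
  infer_instance

variable [IsArtinianRing R]

lemma exists_idempotent_of_le_ker {E Z : Type u} [AddCommGroup E] [Module R E] [Module.Finite R E]
    [AddCommGroup Z] [Module R Z] (J : Submodule R E) (p : E →ₗ[R] Z)
    (hJp : J ≤ LinearMap.ker p)
    (hJ : ∀ W : ModuleCat.{u} R, Indec R W → FdMod R W → (∃ g : W →ₗ[R] Z, g ≠ 0) →
      ExtVanish R W J) :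
    ∃ f : E →ₗ[R] E, f.comp f = f ∧ J ≤ LinearMap.ker f ∧ p.comp f = p := by
  obtain ⟨W₁, W₂, e, hp, hE⟩ := exists_split_of_map_to hJ (E ⧸ J) (J.liftQ p hJp)
  let q : E →ₗ[R] W₁ := (LinearMap.fst R W₁ W₂).comp (e.toLinearMap.comp J.mkQ)
  let q₂ : E →ₗ[R] W₂ := (LinearMap.snd R W₁ W₂).comp (e.toLinearMap.comp J.mkQ)
  have hJ₂ : J ≤ LinearMap.ker q₂ := fun x hx => by
    simp [q₂, (Submodule.Quotient.mk_eq_zero J).2 hx]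
  have hJ₁ : J ≤ LinearMap.ker q := fun x hx => by
    simp [q, (Submodule.Quotient.mk_eq_zero J).2 hx]
  have hsurj : Function.Surjective (q.comp (LinearMap.ker q₂).subtype) := fun w => by
    obtain ⟨x, hx⟩ := J.mkQ_surjective (e.symm (w, 0))
    have hx' : e (J.mkQ x) = (w, 0) := by rw [hx, e.apply_symm_apply]
    exact ⟨⟨x, congrArg Prod.snd hx'⟩, congrArg Prod.fst hx'⟩
  have hker : ∀ x, q x = 0 → q₂ x = 0 → x ∈ J := fun x h₁ h₂ => by
    rw [← Submodule.Quotient.mk_eq_zero J]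
    exact e.map_eq_zero_iff.1 (Prod.ext h₁ h₂)
  obtain ⟨ψ, hψ⟩ := hE.exists_of_exact (Submodule.inclusion hJ₂)
    (q.comp (LinearMap.ker q₂).subtype) (Submodule.inclusion_injective hJ₂) hsurj (by
      ext ⟨x, hx⟩
      simp only [Submodule.range_inclusion, Submodule.mem_comap, Submodule.subtype_apply,
        LinearMap.mem_ker, LinearMap.comp_apply]
      exact ⟨fun h => hJ₁ h, fun h => hker x h hx⟩) LinearMap.id
  obtain ⟨s, hs⟩ := exists_factor_of_surjective (q.comp (LinearMap.ker q₂).subtype) hsurj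
    ((LinearMap.ker q₂).subtype - J.subtype.comp ψ) (by
      rintro ⟨x, hx⟩ hx'
      have := hψ ⟨x, hker x hx' hx⟩
      rw [LinearMap.mem_ker, LinearMap.sub_apply, LinearMap.comp_apply]
      erw [this]
      simp)
  have hqs : ∀ w, q (s w) = w := fun w => by
    obtain ⟨x, rfl⟩ := hsurj w
    rw [hs, LinearMap.sub_apply, map_sub]
    have : q (J.subtype (ψ x)) = 0 := hJ₁ (ψ x).2
    change q x - q (J.subtype (ψ x)) = q x
    rw [this, sub_zero]
  refine ⟨s.comp q, ?_, fun x hx => ?_, ?_⟩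
  · ext x
    simp [hqs]
  · have : q x = 0 := hJ₁ hx
    simp [this]
  · ext x
    have h₁ : q (s (q x) - x) = 0 := by rw [map_sub, hqs, sub_self]
    have h₂ := hp (q₂ (s (q x) - x))
    have h₃ : e.symm (0, q₂ (s (q x) - x)) = J.mkQ (s (q x) - x) := by
      rw [LinearEquiv.symm_apply_eq]
      exact Prod.ext h₁.symm rfl
    rw [h₃, Submodule.mkQ_apply, Submodule.liftQ_apply, map_sub, sub_eq_zero] at h₂
    exact h₂

lemma exists_idempotent_of_comp_eq_zero {E Z J : Type u} [AddCommGroup E] [Module R E]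
    [Module.Finite R E] [AddCommGroup Z] [Module R Z] [AddCommGroup J] [Module R J]
    (g : E →ₗ[R] J) (hg : Function.Surjective g) (i : Z →ₗ[R] E) (hgi : ∀ z, g (i z) = 0)
    (hJ : ∀ W : ModuleCat.{u} R, Indec R W → FdMod R W → (∃ g : Z →ₗ[R] W, g ≠ 0) →
      ExtVanish R J W) :
    ∃ f : E →ₗ[R] E, f.comp f = f ∧ g.comp f = 0 ∧ f.comp i = i := by
  obtain ⟨W₁, W₂, e, hi, hE⟩ := exists_split_of_map_from hJ (LinearMap.ker g)
    (i.codRestrict (LinearMap.ker g) hgi)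
  obtain ⟨ψ, hψ⟩ := hE E g hg ((LinearMap.fst R W₁ W₂).comp e.toLinearMap)
  let s : W₁ →ₗ[R] E := (LinearMap.ker g).subtype.comp
    (e.symm.toLinearMap.comp (LinearMap.inl R W₁ W₂))
  have hs : ∀ w, ψ (s w) = w := fun w => by
    refine (hψ (e.symm (w, 0))).trans ?_
    simp
  refine ⟨s.comp ψ, ?_, ?_, ?_⟩
  · ext x
    simp [hs]
  · ext x
    simp [s]
  · ext z
    have h₁ := hψ (i.codRestrict (LinearMap.ker g) hgi z)
    have h₂ := hi z
    change ψ (i z) = (e (i.codRestrict (LinearMap.ker g) hgi z)).1 at h₁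
    change (LinearMap.ker g).subtype (e.symm (ψ (i z), 0)) = i z
    rw [h₁, ← h₂, Prod.mk.eta, e.symm_apply_apply]
    rfl

/-- `N` is Ext-injective relative to the left part. -/
def LeftExtInjective (N : ModuleCat.{u} R) : Prop :=
  InLeftPart R N ∧ ∀ M : ModuleCat.{u} R, InLeftPart R M → ExtVanish R M N

/-- `N` is Ext-projective relative to the right part. -/
def RightExtProjective (N : ModuleCat.{u} R) : Prop :=
  InRightPart R N ∧ ∀ M : ModuleCat.{u} R, InRightPart R M → ExtVanish R N M

lemma LeftExtInjective.of_step {N N' : ModuleCat.{u} R} (hN : LeftExtInjective N)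
    (h : Step R N N') (hN' : InLeftPart R N') : LeftExtInjective N' := by
  refine ⟨hN', fun M hM => extVanish_of_split fun E _ _ ι π hι hπ he => ?_⟩
  obtain ⟨-, -, hi, hfd, f, hf, -⟩ := h
  have hE : Module.Finite R E := finite_of_exact ι π he hfd hM.2.1
  obtain ⟨d, hd, hJd, hpd⟩ := exists_idempotent_of_le_ker (LinearMap.range (ι.comp f)) π
    (by
      rw [← he]
      exact LinearMap.range_comp_le_range f ι)
    (fun W hW hW' ⟨g, hg⟩ => by
      have hL : InLeftPart R W := hM.of_linked ⟨hW, hW', hM.1, hM.2.1, g, hg⟩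
      exact (hN.2 W hL).of_surjective hL.pdLeOne _ (ι.comp f).surjective_rangeRestrict)
  have hpd' : ∀ x, π (d x) = π x := fun x => LinearMap.congr_fun hpd x
  have hπι : ∀ x, π (ι x) = 0 := fun x => (he ▸ ⟨x, rfl⟩ : ι x ∈ LinearMap.ker π)
  obtain ⟨c, hc⟩ := exists_factor_of_injective ι hι (d.comp ι) (by
    rintro _ ⟨x, rfl⟩
    rw [he, LinearMap.mem_ker, LinearMap.comp_apply, hpd', hπι])
  simp only [LinearMap.comp_apply] at hc
  have hcc : c.comp c = c := by
    ext x
    apply hι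
    rw [LinearMap.comp_apply, hc, hc]
    exact LinearMap.congr_fun hd (ι x)
  have hcf : ∀ x, c (f x) = 0 := fun x => hι (by
    rw [hc, map_zero]
    exact hJd ⟨x, rfl⟩)
  have hc0 : c = 0 := by
    refine (hi.2 c hcc).resolve_right fun h1 => hf ?_
    ext x
    simpa [h1] using hcf x
  obtain ⟨ρ, hρ⟩ := exists_factor_of_injective ι hι (LinearMap.id - d) (by
    rintro _ ⟨x, rfl⟩
    rw [he, LinearMap.mem_ker, LinearMap.sub_apply, map_sub, hpd', LinearMap.id_apply, sub_self])
  refine ⟨ρ, fun x => hι ?_⟩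
  rw [hρ, LinearMap.sub_apply, ← hc, hc0]
  simp

lemma RightExtProjective.of_step {N N' : ModuleCat.{u} R} (hN : RightExtProjective N)
    (h : Step R N' N) (hN' : InRightPart R N') : RightExtProjective N' := by
  refine ⟨hN', fun M hM => extVanish_of_split fun E _ _ ι π hι hπ he => ?_⟩
  obtain ⟨hi, hfd, -, -, f, hf, -⟩ := h
  have hE : Module.Finite R E := finite_of_exact ι π he hM.2.1 hfd
  have hπι : ∀ x, π (ι x) = 0 := fun x => (he ▸ ⟨x, rfl⟩ : ι x ∈ LinearMap.ker π)
  obtain ⟨d, hd, hgd, hdi⟩ := exists_idempotent_of_comp_eq_zero (f.rangeRestrict.comp π)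
    (f.surjective_rangeRestrict.comp hπ) ι (fun z => Subtype.ext (by
      change f (π (ι z)) = 0
      rw [hπι, map_zero]))
    (fun W hW hW' ⟨g, hg⟩ => by
      have hL : InRightPart R W := hM.of_linked ⟨hM.1, hM.2.1, hW, hW', g, hg⟩
      exact (hN.2 W hL).of_injective hL.idLeOne _ (LinearMap.range f).injective_subtype)
  have hdi' : ∀ x, d (ι x) = ι x := fun x => LinearMap.congr_fun hdi x
  have hgd' : ∀ x, f (π (d x)) = 0 := fun x =>
    congrArg Subtype.val (LinearMap.congr_fun hgd x)
  obtain ⟨c, hc⟩ := exists_factor_of_surjective π hπ (π.comp d) (by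
    rw [← he]
    rintro _ ⟨x, rfl⟩
    rw [LinearMap.mem_ker, LinearMap.comp_apply, hdi', hπι])
  simp only [LinearMap.comp_apply] at hc
  have hcc : c.comp c = c := by
    ext x
    obtain ⟨x, rfl⟩ := hπ x
    rw [LinearMap.comp_apply, hc, hc]
    exact congrArg π (LinearMap.congr_fun hd x)
  have hc0 : c = 0 := by
    refine (hi.2 c hcc).resolve_right fun h1 => hf ?_
    ext x
    obtain ⟨x, rfl⟩ := hπ x
    have := hgd' x
    rw [← hc, h1] at this
    exact this
  obtain ⟨ρ, hρ⟩ := exists_factor_of_injective ι hι d (by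
    rintro _ ⟨x, rfl⟩
    rw [he, LinearMap.mem_ker, ← hc, hc0, LinearMap.zero_apply])
  exact ⟨ρ, fun x => hι (by rw [hρ, hdi'])⟩

lemma LeftExtInjective.comp_ne_zero {M N Z : ModuleCat.{u} R} (hM : LeftExtInjective M)
    (hN : LeftExtInjective N) (hZ : LeftExtInjective Z) {f : M →ₗ[R] N} {g : N →ₗ[R] Z}
    (hf : f ≠ 0) (hg : g ≠ 0) : g.comp f ≠ 0 := by
  intro h
  have hE : Module.Finite R N := hN.1.2.1
  obtain ⟨d, hd, hJd, hpd⟩ := exists_idempotent_of_le_ker (LinearMap.range f) g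
    (LinearMap.range_le_ker_iff.2 h) (fun W hW hW' ⟨q, hq⟩ => by
      have hL : InLeftPart R W := hZ.1.of_linked ⟨hW, hW', hZ.1.1, hZ.1.2.1, q, hq⟩
      exact (hM.2 W hL).of_surjective hL.pdLeOne _ f.surjective_rangeRestrict)
  rcases hN.1.1.2 d hd with rfl | rfl
  · exact hg (by rw [← hpd, LinearMap.comp_zero])
  · rw [LinearMap.ker_id, le_bot_iff, LinearMap.range_eq_bot] at hJd
    exact hf hJd

lemma RightExtProjective.comp_ne_zero {M N Z : ModuleCat.{u} R} (hM : RightExtProjective M)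
    (hN : RightExtProjective N) (hZ : RightExtProjective Z) {f : M →ₗ[R] N} {g : N →ₗ[R] Z}
    (hf : f ≠ 0) (hg : g ≠ 0) : g.comp f ≠ 0 := by
  intro h
  have hE : Module.Finite R N := hN.1.2.1
  obtain ⟨d, hd, hgd, hdi⟩ := exists_idempotent_of_comp_eq_zero g.rangeRestrict
    g.surjective_rangeRestrict f (fun z => Subtype.ext (LinearMap.congr_fun h z))
    (fun W hW hW' ⟨q, hq⟩ => by
      have hL : InRightPart R W := hM.1.of_linked ⟨hM.1.1, hM.1.2.1, hW, hW', q, hq⟩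
      exact (hZ.2 W hL).of_injective hL.idLeOne _ (LinearMap.range g).injective_subtype)
  rcases hN.1.1.2 d hd with rfl | rfl
  · exact hf (by rw [← hdi, LinearMap.zero_comp])
  · refine hg ?_
    ext x
    exact congrArg Subtype.val (LinearMap.congr_fun hgd x)

/-- No cycle can pass through a class of modules in which nonzero maps compose to nonzero maps. -/
lemma not_transGen_of_comp_ne_zero (C : ModuleCat.{u} R → Prop)
    (hC : ∀ M N Z : ModuleCat.{u} R, C M → C N → C Z → ∀ (f : M →ₗ[R] N) (g : N →ₗ[R] Z),
      f ≠ 0 → g ≠ 0 → g.comp f ≠ 0) {X : ModuleCat.{u} R}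
    (hX : ∀ M, Relation.ReflTransGen (Step R) X M → Relation.ReflTransGen (Step R) M X → C M) :
    ¬ Relation.TransGen (Step R) X X := by
  intro h
  have hCX : C X := hX X .refl .refl
  have key : ∀ M, Relation.TransGen (Step R) X M → Relation.ReflTransGen (Step R) M X →
      ∃ f : X →ₗ[R] M, f ≠ 0 ∧ ¬ Function.Bijective f := by
    intro M hM
    induction hM with
    | single hs => exact fun _ => hs.2.2.2.2
    | tail h₁ hs ih =>
      intro h₂
      obtain ⟨f, hf, hf'⟩ := ih (h₂.head hs)
      have hs' := hs
      obtain ⟨hi₁, -, hi₂, -, g, hg, hg'⟩ := hs'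
      refine ⟨g.comp f, hC _ _ _ hCX (hX _ h₁.to_reflTransGen (h₂.head hs))
        (hX _ (h₁.tail hs).to_reflTransGen h₂) f g hf hg, fun hb => hg' ?_⟩
      obtain ⟨Z, hZ, -⟩ := Relation.TransGen.head'_iff.1 h
      exact bijective_of_bijective_comp hi₁ hZ.1 hb
  obtain ⟨f, hf, hf'⟩ := key X h .refl
  obtain ⟨Z, hZ, -⟩ := Relation.TransGen.head'_iff.1 h
  obtain ⟨hi, hfd, -⟩ := hZ
  have hfd' : Module.Finite R X := hfd
  have hi' := hi.1
  have hpow : ∀ n, ((f : Module.End R X) ^ n) ≠ 0 := by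
    intro n
    induction n with
    | zero => rw [pow_zero]; exact one_ne_zero
    | succ n ih => exact hC X X X hCX hCX hCX f ((f : Module.End R X) ^ n) hf ih
  obtain ⟨n, hn⟩ := Filter.eventually_atTop.1
    (LinearMap.eventually_isCompl_ker_pow_range_pow (f : Module.End R X))
  have hc := hn (n + 1) (Nat.le_succ n)
  obtain ⟨π, hπ, hπ'⟩ : ∃ π : X →ₗ[R] X, π.comp π = π ∧ LinearMap.ker π =
      LinearMap.ker ((f : Module.End R X) ^ (n + 1)) :=
    ⟨Submodule.projection _ _ hc.symm, (Submodule.isIdempotentElem_projection hc.symm).eq,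
      Submodule.ker_projection hc.symm⟩
  rcases hi.2 π hπ with rfl | rfl
  · rw [LinearMap.ker_zero, eq_comm, LinearMap.ker_eq_top] at hπ'
    exact hpow _ hπ'
  · rw [LinearMap.ker_id, eq_comm, LinearMap.ker_eq_bot] at hπ'
    refine hf' (IsArtinian.bijective_of_injective_endomorphism f ?_)
    rw [pow_succ] at hπ'
    exact Function.Injective.of_comp hπ'

lemma directed_of_injective_of_inLeftPart {X : ModuleCat.{u} R} (hX : Module.Injective R X)
    (hL : InLeftPart R X) : Directed R X := by
  refine not_transGen_of_comp_ne_zero LeftExtInjective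
    (fun M N Z hM hN hZ f g hf hg => hM.comp_ne_zero hN hZ hf hg) fun M h₁ h₂ => ?_
  have hM := hL.of_indPath h₂
  clear h₂
  induction h₁ with
  | refl => exact ⟨hL, fun M _ => extVanish_of_injective⟩
  | tail _ h ih => exact (ih (hM.of_linked h.linked)).of_step h hM

lemma directed_of_projective_of_inRightPart {X : ModuleCat.{u} R} (hX : Module.Projective R X)
    (hL : InRightPart R X) : Directed R X := by
  refine not_transGen_of_comp_ne_zero RightExtProjective
    (fun M N Z hM hN hZ f g hf hg => hM.comp_ne_zero hN hZ hf hg) fun M h₁ h₂ => ?_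
  have hM := hL.of_indPath h₁
  clear h₁
  induction h₂ using Relation.ReflTransGen.head_induction_on with
  | refl =>
    refine ⟨hL, fun M _ E _ _ π hπ φ => ?_⟩
    obtain ⟨s, hs⟩ := Module.projective_lifting_property π LinearMap.id hπ
    have hs' : ∀ x, π (s x) = x := fun x => LinearMap.congr_fun hs x
    refine ⟨φ.comp ((LinearMap.id - s.comp π).codRestrict (LinearMap.ker π)
      (fun x => by simp [hs'])), fun x => ?_⟩
    rw [LinearMap.comp_apply]
    congr 1
    ext
    simp
  | head h _ ih => exact (ih (hM.of_linked h.linked)).of_step h hM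

/-- Over a weakly shod ring, there is no path from an injective module `X` to a projective module
`Y` if there is a chain of nonzero maps from `Y` to `X`. -/
theorem not_transGen_of_weaklyShod (hR : WeaklyShod R) {X Y : ModuleCat.{u} R} (hX : Indec R X)
    (hX' : FdMod R X) (hXI : Module.Injective R X) (hYP : Module.Projective R Y)
    (hYX : Relation.ReflTransGen Linked Y X) : ¬ Relation.TransGen (Step R) X Y := by
  intro hXY
  have hc := transGen_step_linked_chain hXY hYX
  by_cases hL : InLeftPart R X
  · exact directed_of_injective_of_inLeftPart hXI hL hc
  · by_cases hR' : InRightPart R X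
    · exact directed_of_projective_of_inRightPart hYP (hR'.of_indPath hXY.to_reflTransGen)
        (linked_chain_transGen_step hYX hXY)
    · exact hR X hX hX' hL hR' hc

end DirectedCycles

end Toupie

namespace Toupie

/-! ### Triangular systems of idempotents -/

section Triangular

/-- A complete system of nonzero orthogonal idempotents of a `k`-algebra for which the algebra is
triangular with one-dimensional diagonal blocks. -/
structure TriangularIdempotents (k R ι : Type*) [Field k] [Ring R] [Algebra k R] [Fintype ι] where
  ε : ι → R
  height : ι → ℕ∞
  complete : CompleteOrthogonalIdempotents ε
  ne_zero : ∀ v, ε v ≠ 0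
  triangular : ∀ x v w, v ≠ w → ¬ height v < height w → ε w * x * ε v = 0
  diagonal : ∀ x v, ∃ c : k, ε v * x * ε v = c • ε v

/-- The `k`-linear functionals on `R`, as a left `R`-module. -/
def Coregular (k R : Type u) [Field k] [Ring R] [Algebra k R] : Type u := R →ₗ[k] k

variable {k R : Type u} [Field k] [Ring R] [Algebra k R]

instance : AddCommGroup (Coregular k R) := inferInstanceAs (AddCommGroup (R →ₗ[k] k))

instance : Module k (Coregular k R) := inferInstanceAs (Module k (R →ₗ[k] k))

instance : FunLike (Coregular k R) R k := inferInstanceAs (FunLike (R →ₗ[k] k) R k)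

instance : LinearMapClass (Coregular k R) k R k :=
  inferInstanceAs (LinearMapClass (R →ₗ[k] k) k R k)

namespace Coregular

@[ext] lemma ext {φ ψ : Coregular k R} (h : ∀ x, φ x = ψ x) : φ = ψ := LinearMap.ext h

@[simp] lemma add_apply (φ ψ : Coregular k R) (x : R) : (φ + ψ) x = φ x + ψ x := rfl

@[simp] lemma zero_apply (x : R) : (0 : Coregular k R) x = 0 := rfl

instance : SMul R (Coregular k R) where
  smul r φ := LinearMap.comp (M₂ := R) φ (LinearMap.mulRight k r)

@[simp] lemma smul_apply (r : R) (φ : Coregular k R) (x : R) : (r • φ) x = φ (x * r) := rfl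

@[simp] lemma field_smul_apply (c : k) (φ : Coregular k R) (x : R) : (c • φ) x = c * φ x := rfl

instance : Module R (Coregular k R) where
  one_smul φ := ext fun x => by simp
  mul_smul r s φ := ext fun x => by simp [mul_assoc]
  smul_zero r := ext fun x => by simp
  smul_add r φ ψ := ext fun x => by simp
  add_smul r s φ := ext fun x => by simp [mul_add]
  zero_smul φ := ext fun x => by simp

instance : IsScalarTower k R (Coregular k R) where
  smul_assoc c r φ := ext fun x => by simp

end Coregular

variable {ι : Type*} [Fintype ι] (S : TriangularIdempotents k R ι)

namespace TriangularIdempotents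

lemma mul_self (v : ι) : S.ε v * S.ε v = S.ε v := S.complete.idem v

lemma mul_of_ne {v w : ι} (h : v ≠ w) : S.ε v * S.ε w = 0 := S.complete.ortho h

lemma exists_smul_ne_zero {M : Type*} [AddCommGroup M] [Module R M] {m : M} (hm : m ≠ 0) :
    ∃ v, S.ε v • m ≠ 0 := by
  by_contra! h
  apply hm
  rw [← one_smul R m, ← S.complete.complete, Finset.sum_smul, Finset.sum_eq_zero fun v _ => h v]

lemma exists_mul_ne_zero {x : R} (hx : x ≠ 0) : ∃ v, x * S.ε v ≠ 0 := by
  by_contra! h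
  apply hx
  rw [← mul_one x, ← S.complete.complete, Finset.mul_sum, Finset.sum_eq_zero fun v _ => h v]

lemma exists_functional {x : R} (hx : x ≠ 0) : ∃ g : R →ₗ[k] k, g x = 1 := by
  obtain ⟨g, hg⟩ := Module.Projective.exists_dual_ne_zero k hx
  exact ⟨(g x)⁻¹ • g, by simp [hg]⟩

/-- The character of `R` on the diagonal block at `v`. -/
def diag (v : ι) : Coregular k R :=
  LinearMap.comp (M₂ := R) (exists_functional (k := k) (S.ne_zero v)).choose
    ((LinearMap.mulRight k (S.ε v)).comp (LinearMap.mulLeft k (S.ε v)))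

lemma diag_spec (v : ι) (x : R) : S.ε v * x * S.ε v = S.diag v x • S.ε v := by
  obtain ⟨c, hc⟩ := S.diagonal x v
  have h := (exists_functional (k := k) (S.ne_zero v)).choose_spec
  have : S.diag v x = c := by
    change (exists_functional (k := k) (S.ne_zero v)).choose (S.ε v * x * S.ε v) = c
    rw [hc, map_smul, h, smul_eq_mul, mul_one]
  rw [this, hc]

lemma diag_eq {v : ι} {x : R} {c : k} (h : S.ε v * x * S.ε v = c • S.ε v) : S.diag v x = c :=
  smul_left_injective k (S.ne_zero v) ((S.diag_spec v x).symm.trans h)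

lemma diag_one (v : ι) : S.diag v 1 = 1 := S.diag_eq (by rw [mul_one, mul_self, one_smul])

lemma diag_self_mul (v : ι) (x : R) : S.diag v (S.ε v * x) = S.diag v x :=
  S.diag_eq (by rw [← mul_assoc, mul_self, diag_spec])

lemma diag_of_ne {v w : ι} (h : v ≠ w) : S.diag v (S.ε w) = 0 :=
  S.diag_eq (by rw [S.mul_of_ne h, zero_mul, zero_smul])

/-- Every nonzero module contains a simple submodule on which `R` acts through a diagonal
character. -/
lemma exists_socle (M : Type*) [AddCommGroup M] [Module R M] [Nontrivial M] :
    ∃ (v : ι) (m : M), m ≠ 0 ∧ ∀ r : R, r • m = algebraMap k R (S.diag v r) • m := by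
  obtain ⟨m₀, hm₀⟩ := exists_ne (0 : M)
  obtain ⟨v, ⟨m, hm⟩, hv⟩ := Set.exists_max_image {v | ∃ m : M, S.ε v • m ≠ 0} S.height
    (Set.toFinite _) ((S.exists_smul_ne_zero hm₀).imp fun v hv => ⟨m₀, hv⟩)
  refine ⟨v, S.ε v • m, hm, fun r => ?_⟩
  rw [← one_smul R (r • S.ε v • m), ← S.complete.complete, Finset.sum_smul,
    Finset.sum_eq_single v, smul_smul, smul_smul, S.diag_spec, smul_smul, Algebra.smul_def]
  · intro w _ hw
    by_cases hh : S.height v < S.height w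
    · by_contra hne
      exact absurd (hv w ⟨_, hne⟩) (not_le.2 hh)
    · rw [smul_smul, smul_smul, S.triangular r v w hw.symm hh, zero_smul]
  · simp

lemma diag_mul_of_socle {M : Type*} [AddCommGroup M] [Module R M] {v : ι} {m : M} (hm : m ≠ 0)
    (h : ∀ r : R, r • m = algebraMap k R (S.diag v r) • m) (r s : R) :
    S.diag v (r * s) = S.diag v s * S.diag v r := by
  by_contra hne
  have h₀ : algebraMap k R (S.diag v (r * s) - S.diag v s * S.diag v r) • m = 0 := by
    rw [map_sub, sub_smul, ← h, mul_smul, h s, smul_smul, ← Algebra.commutes, mul_smul, h r,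
      smul_smul, ← map_mul, sub_self]
  apply hm
  rw [← one_smul R m, ← map_one (algebraMap k R), ← inv_mul_cancel₀ (sub_ne_zero.2 hne), map_mul,
    mul_smul, h₀, smul_zero]

/-- The indecomposable projective module at `v`. -/
def proj (v : ι) : Submodule R R := Submodule.span R {S.ε v}

lemma mem_proj {v : ι} {x : R} : x ∈ S.proj v ↔ x * S.ε v = x := by
  rw [proj, Submodule.mem_span_singleton]
  refine ⟨?_, fun h => ⟨x, h⟩⟩
  rintro ⟨y, rfl⟩
  rw [smul_eq_mul, mul_assoc, mul_self]

/-- The generator of `S.proj v`. -/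
def gen (v : ι) : S.proj v := ⟨S.ε v, S.mem_proj.2 (S.mul_self v)⟩

lemma coe_smul_gen {v : ι} (x : S.proj v) : (x : R) • S.gen v = x :=
  Subtype.ext (S.mem_proj.1 x.2)

lemma gen_ne_zero (v : ι) : S.gen v ≠ 0 := fun h => S.ne_zero v (congrArg Subtype.val h)

lemma indec_proj (v : ι) : Indec R (ModuleCat.of R (S.proj v)) := by
  refine ⟨⟨S.gen v, 0, S.gen_ne_zero v⟩, fun (f : S.proj v →ₗ[R] S.proj v) hf => ?_⟩
  have h₁ : ∀ x, f x = (x : R) • f (S.gen v) := fun x => by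
    rw [← map_smul, coe_smul_gen]
  obtain ⟨c, hc⟩ : ∃ c : k, f (S.gen v) = algebraMap k R c • S.gen v := by
    refine ⟨S.diag v (f (S.gen v)), Subtype.ext ?_⟩
    change _ = algebraMap k R (S.diag v (f (S.gen v))) * S.ε v
    rw [← Algebra.smul_def, ← S.diag_spec, mul_assoc, S.mem_proj.1 (f (S.gen v)).2]
    exact congrArg Subtype.val (h₁ (S.gen v))
  have h₂ := LinearMap.congr_fun hf (S.gen v)
  rw [LinearMap.comp_apply, hc, map_smul, hc, smul_smul, ← map_mul, ← sub_eq_zero, ← sub_smul,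
    ← map_sub] at h₂
  have h₃ : c * c - c = 0 := by
    have : (c * c - c) • S.ε v = 0 := by
      rw [Algebra.smul_def]
      exact congrArg Subtype.val h₂
    exact (smul_eq_zero.1 this).resolve_right (S.ne_zero v)
  have h₄ : c = 0 ∨ c = 1 := by
    rcases mul_eq_zero.1 (show c * (c - 1) = 0 by linear_combination h₃) with h | h
    · exact .inl h
    · exact .inr (sub_eq_zero.1 h)
  rcases h₄ with rfl | rfl
  · left
    ext x
    rw [h₁, hc, map_zero, zero_smul, smul_zero, LinearMap.zero_apply]
  · right
    ext x
    rw [h₁, hc, map_one, one_smul, coe_smul_gen, LinearMap.id_apply]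

lemma fdMod_proj (v : ι) : FdMod R (ModuleCat.of R (S.proj v)) :=
  inferInstanceAs (Module.Finite R (Submodule.span R {S.ε v}))

lemma linked_proj {M : ModuleCat.{u} R} (hM : Indec R M) (hM' : FdMod R M) {v : ι} {m : M}
    (hm : S.ε v • m ≠ 0) : Linked (ModuleCat.of R (S.proj v)) M := by
  refine ⟨S.indec_proj v, S.fdMod_proj v, hM, hM',
    (LinearMap.toSpanSingleton R M m).comp (S.proj v).subtype, fun h => hm ?_⟩
  exact LinearMap.congr_fun h (S.gen v)

lemma linked_proj_proj {v w : ι} {x : R} (hx : S.ε w * x * S.ε v ≠ 0) :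
    Linked (ModuleCat.of R (S.proj w)) (ModuleCat.of R (S.proj v)) := by
  refine S.linked_proj (S.indec_proj v) (S.fdMod_proj v) (m := x • S.gen v) fun h => hx ?_
  rw [mul_assoc]
  exact congrArg Subtype.val h

lemma exists_linked_proj {Y : ModuleCat.{u} R} (hY : Indec R Y) (hY' : FdMod R Y)
    (hYP : Module.Projective R Y) : ∃ v, Linked Y (ModuleCat.of R (S.proj v)) := by
  obtain ⟨s, hs⟩ := hYP.out
  have := hY.1
  obtain ⟨y, hy⟩ := exists_ne (0 : Y)
  have hsy : s y ≠ 0 := fun h => hy (by rw [← hs y, h, map_zero])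
  obtain ⟨z, hz⟩ := Finsupp.ne_iff.1 hsy
  obtain ⟨v, hv⟩ := S.exists_mul_ne_zero hz
  refine ⟨v, hY, hY', S.indec_proj v, S.fdMod_proj v,
    ((LinearMap.toSpanSingleton R R (S.ε v)).comp
      ((Finsupp.lapply z).comp s)).codRestrict (S.proj v) fun x => ?_, fun h => hv ?_⟩
  · rw [mem_proj]
    simp [mul_assoc, mul_self]
  · exact congrArg Subtype.val (LinearMap.congr_fun h y)

/-- The indecomposable injective module at `v`. -/
def inj (v : ι) : Submodule R (Coregular k R) where
  carrier := {φ | ∀ x, φ (S.ε v * x) = φ x}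
  zero_mem' _ := rfl
  add_mem' h₁ h₂ x := by simp [h₁ x, h₂ x]
  smul_mem' r φ h x := by simp [mul_assoc, h (x * r)]

lemma inj_apply {v : ι} (φ : S.inj v) (x : R) :
    (φ : Coregular k R) (S.ε v * x) = (φ : Coregular k R) x := φ.2 x

/-- The elements of `S.inj v` on which `R` acts through a diagonal character are the multiples of
`S.diag v`. -/
lemma eq_smul_diag_of_socle {v w : ι} {φ : S.inj v} (hφ : φ ≠ 0)
    (h : ∀ r : R, r • φ = algebraMap k R (S.diag w r) • φ) :
    ∃ c : k, c ≠ 0 ∧ (φ : Coregular k R) = c • S.diag v := by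
  have h' : ∀ r x : R, (φ : Coregular k R) (x * r) = S.diag w r * (φ : Coregular k R) x := by
    intro r x
    have := congrArg (fun ψ : S.inj v => (ψ : Coregular k R) x) (h r)
    simp only [Submodule.coe_smul, Coregular.smul_apply] at this
    rw [this, ← Algebra.commutes, ← Algebra.smul_def, map_smul, smul_eq_mul]
  have h₁ : (φ : Coregular k R) = ((φ : Coregular k R) 1) • S.diag w := by
    ext x
    rw [Coregular.field_smul_apply, ← one_mul x, h', one_mul, mul_comm]
  have hc : (φ : Coregular k R) 1 ≠ 0 := fun h0 => hφ (Subtype.ext (by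
    rw [h₁, h0, zero_smul]
    rfl))
  have hwv : w = v := by
    by_contra hne
    apply hc
    rw [← S.inj_apply φ 1, h₁, Coregular.field_smul_apply, mul_one, S.diag_of_ne hne, mul_zero]
  exact ⟨_, hc, hwv ▸ h₁⟩

/-- The functional on `R` obtained by composing with left multiplication by `S.ε v`. -/
def injOf (v : ι) (g : R →ₗ[k] k) : S.inj v :=
  ⟨LinearMap.comp (M₂ := R) g (LinearMap.mulLeft k (S.ε v)), fun x => by
    change g (S.ε v * (S.ε v * x)) = g (S.ε v * x)
    rw [← mul_assoc, mul_self]⟩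

lemma injOf_apply (v : ι) (g : R →ₗ[k] k) (x : R) :
    (S.injOf v g : Coregular k R) x = g (S.ε v * x) := rfl

lemma indec_inj (v : ι) : Indec R (ModuleCat.of R (S.inj v)) := by
  refine ⟨?_, fun (f : S.inj v →ₗ[R] S.inj v) hf => ?_⟩
  · obtain ⟨g, hg⟩ := exists_functional (k := k) (S.ne_zero v)
    refine ⟨S.injOf v g, 0, fun h => one_ne_zero (α := k) ?_⟩
    rw [← hg, ← mul_one (S.ε v), ← injOf_apply]
    exact congrArg (fun ψ : S.inj v => (ψ : Coregular k R) 1) h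
  · have key : ∀ N : Submodule R (S.inj v), N ≠ ⊥ →
        ∃ φ ∈ N, ∃ c : k, c ≠ 0 ∧ (φ : Coregular k R) = c • S.diag v := by
      intro N hN
      have : Nontrivial N := Submodule.nontrivial_iff_ne_bot.2 hN
      obtain ⟨w, φ, hφ, h⟩ := S.exists_socle N
      exact ⟨φ, φ.2, S.eq_smul_diag_of_socle (w := w) (fun h0 => hφ (Subtype.ext h0))
        fun r => congrArg Subtype.val (h r)⟩
    by_contra! hc
    obtain ⟨φ, ⟨χ, rfl⟩, c, hc0, hφ⟩ := key (LinearMap.range f)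
      (fun h => hc.1 (LinearMap.range_eq_bot.1 h))
    obtain ⟨ψ, hψ, d, hd0, hψ'⟩ := key (LinearMap.ker f) (fun h => hc.2 (by
      ext1 x
      exact (LinearMap.ker_eq_bot.1 h) (LinearMap.congr_fun hf x)))
    have h₁ : f χ = algebraMap k R (c * d⁻¹) • ψ := Subtype.ext (by
      rw [hφ, Submodule.coe_smul, hψ', algebraMap_smul, smul_smul, mul_assoc,
        inv_mul_cancel₀ hd0, mul_one])
    have h₂ : f χ = 0 := by
      have := LinearMap.congr_fun hf χ
      rw [LinearMap.comp_apply, h₁, map_smul, LinearMap.mem_ker.1 hψ, smul_zero] at this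
      rw [h₁]
      exact this.symm
    rw [h₂] at hφ
    have h₃ := congrArg (fun ψ : Coregular k R => ψ 1) hφ
    rw [Coregular.field_smul_apply, diag_one, mul_one] at h₃
    exact hc0 h₃.symm

variable [FiniteDimensional k R]

lemma fdMod_inj (v : ι) : FdMod R (ModuleCat.of R (S.inj v)) := by
  have : Module.Finite k (Coregular k R) := inferInstanceAs (Module.Finite k (R →ₗ[k] k))
  have : Module.Finite k (S.inj v) :=
    inferInstanceAs (Module.Finite k ((S.inj v).restrictScalars k))
  exact Module.Finite.of_restrictScalars_finite k R (S.inj v)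

lemma linked_proj_inj {v w : ι} {x : R} (hx : S.ε w * x * S.ε v ≠ 0) :
    Linked (ModuleCat.of R (S.proj v)) (ModuleCat.of R (S.inj w)) := by
  obtain ⟨g, hg⟩ := exists_functional (k := k) hx
  refine S.linked_proj (S.indec_inj w) (S.fdMod_inj w) (m := S.injOf w g) fun h => ?_
  have h' := congrArg (fun ψ : S.inj w => (ψ : Coregular k R) x) h
  change g (S.ε w * (x * S.ε v)) = 0 at h'
  rw [← mul_assoc, hg] at h'
  exact one_ne_zero h'

lemma linked_inj_inj {v w : ι} {x : R} (hx : S.ε w * x * S.ε v ≠ 0) :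
    Linked (ModuleCat.of R (S.inj w)) (ModuleCat.of R (S.inj v)) := by
  let F : S.inj w →ₗ[R] S.inj v :=
    { toFun := fun φ => ⟨LinearMap.comp (M₂ := R) (φ : Coregular k R)
          (LinearMap.mulLeft k (x * S.ε v)), fun y => by
            change (φ : Coregular k R) (x * S.ε v * (S.ε v * y)) =
              (φ : Coregular k R) (x * S.ε v * y)
            rw [← mul_assoc, mul_assoc x, mul_self]⟩
      map_add' := fun φ ψ => rfl
      map_smul' := fun r φ => Subtype.ext (Coregular.ext fun y => by
        change (φ : Coregular k R) (x * S.ε v * y * r) = (φ : Coregular k R) (x * S.ε v * (y * r))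
        rw [mul_assoc]) }
  obtain ⟨g, hg⟩ := exists_functional (k := k) hx
  refine ⟨S.indec_inj w, S.fdMod_inj w, S.indec_inj v, S.fdMod_inj v, F, fun h => ?_⟩
  have h' := congrArg (fun ψ : S.inj v => (ψ : Coregular k R) 1)
    (LinearMap.congr_fun h (S.injOf w g))
  change g (S.ε w * (x * S.ε v * 1)) = 0 at h'
  rw [mul_one, ← mul_assoc, hg] at h'
  exact one_ne_zero h'

lemma exists_linked_inj {X : ModuleCat.{u} R} (hX : Indec R X) (hX' : FdMod R X)
    (hXI : Module.Injective R X) : ∃ v, Linked (ModuleCat.of R (S.inj v)) X := by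
  have := hX.1
  obtain ⟨v, m, hm, h⟩ := S.exists_socle X
  let N : Submodule R (S.inj v) :=
    { carrier := {φ | ∀ x r : R, (φ : Coregular k R) (x * r) =
        S.diag v r * (φ : Coregular k R) x}
      zero_mem' := fun x r => (mul_zero _).symm
      add_mem' := fun {φ ψ} h₁ h₂ x r => by
        simp [h₁ x r, h₂ x r, mul_add]
      smul_mem' := fun s φ h₁ x r => by
        simp only [Submodule.coe_smul, Coregular.smul_apply]
        rw [h₁, h₁, h₁]
        ring }
  let F : N →ₗ[R] X :=
    { toFun := fun φ => algebraMap k R (((φ : S.inj v) : Coregular k R) 1) • m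
      map_add' := fun φ ψ => by simp [add_smul]
      map_smul' := fun r φ => by
        have := φ.2 1 r
        simp only [Submodule.coe_smul, Coregular.smul_apply, RingHom.id_apply]
        rw [this, smul_smul, ← Algebra.commutes, mul_smul, h r, smul_smul, ← map_mul, mul_comm] }
  obtain ⟨G, hG⟩ := hXI.out N.subtype N.injective_subtype F
  let χ : N := ⟨⟨S.diag v, S.diag_self_mul v⟩, fun x r => S.diag_mul_of_socle hm h x r⟩
  refine ⟨v, S.indec_inj v, S.fdMod_inj v, hX, hX', G, fun h0 => hm ?_⟩
  have := hG χ
  rw [h0] at this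
  have h₁ : F χ = m := by
    change algebraMap k R (S.diag v 1) • m = m
    rw [diag_one, map_one, one_smul]
  rw [← h₁, ← this]
  rfl

end TriangularIdempotents

end Triangular

end Toupie

namespace Toupie

/-! ### The triangular structure of a toupie algebra -/

section PathAlgebra

variable {t : ℕ} {ℓ : Fin t → ℕ}

instance : Finite (Vtx t ℓ) :=
  Finite.of_surjective
    (fun x : Option (Option (Σ i : Fin t, Fin (ℓ i - 1))) => match x with
      | none => Vtx.src
      | some none => Vtx.snk
      | some (some p) => Vtx.mid p.1 p.2) (by
    rintro (_ | _ | ⟨i, a⟩)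
    · exact ⟨none, rfl⟩
    · exact ⟨some none, rfl⟩
    · exact ⟨some (some ⟨i, a⟩), rfl⟩)

instance : Fintype (Vtx t ℓ) := Fintype.ofFinite _

instance : Finite (PIdx t ℓ) :=
  Finite.of_surjective
    (fun x : Vtx t ℓ ⊕ Σ i : Fin t, {p : Fin (ℓ i + 1) × Fin (ℓ i + 1) // p.1 < p.2} =>
      match x with
      | .inl v => PIdx.vert v
      | .inr p => PIdx.sub p.1 p.2.1.1 p.2.1.2 p.2.2 (Nat.le_of_lt_succ p.2.1.2.2)) (by
    rintro (v | ⟨i, a, b, hab, hb⟩)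
    · exact ⟨.inl v, rfl⟩
    · exact ⟨.inr ⟨i, ⟨⟨a, by omega⟩, ⟨b, by omega⟩⟩, hab⟩, rfl⟩)

/-- The distance from the source, the sink being at infinity. -/
def vtxHeight : Vtx t ℓ → ℕ∞
  | .src => 0
  | .snk => ⊤
  | .mid _ a => ((a + 1 : ℕ) : ℕ∞)

lemma vtxHeight_lt {i : Fin t} {j : ℕ} (hj : j < ℓ i) :
    vtxHeight (vtx t ℓ i j) < vtxHeight (vtx t ℓ i (j + 1)) := by
  have h₁ : vtxHeight (vtx t ℓ i j) = j := by
    rcases Nat.eq_zero_or_pos j with rfl | h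
    · simp [vtx, vtxHeight]
    · rw [vtx, if_neg h.ne', dif_pos (by omega), vtxHeight]
      exact congrArg _ (by simp; omega)
  rw [h₁, vtx, if_neg (Nat.succ_ne_zero j)]
  split_ifs with h
  · simp only [vtxHeight, Nat.add_sub_cancel]
    exact_mod_cast Nat.lt_succ_self j
  · exact ENat.natCast_lt_top j

lemma vtx_length {i : Fin t} (hi : 1 ≤ ℓ i) : vtx t ℓ i (ℓ i) = Vtx.snk := by
  rw [vtx, if_neg (by omega), dif_neg (lt_irrefl _)]

lemma exists_eq_vtx (ht : 0 < t) (hℓ : ∀ i, 1 ≤ ℓ i) (v : Vtx t ℓ) :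
    ∃ i j, j ≤ ℓ i ∧ v = vtx t ℓ i j := by
  rcases v with _ | _ | ⟨i, a⟩
  · exact ⟨⟨0, ht⟩, 0, Nat.zero_le _, rfl⟩
  · exact ⟨⟨0, ht⟩, _, le_rfl, (vtx_length (hℓ _)).symm⟩
  · refine ⟨i, a + 1, by omega, ?_⟩
    rw [vtx, if_neg (Nat.succ_ne_zero _), dif_pos (by simp)]
    rfl

lemma startIdx_of_strip {i : Fin t} {j : ℕ} {p q : PIdx t ℓ} (h : strip i j p = some q) :
    j < ℓ i ∧ startIdx p = vtx t ℓ i j ∧ startIdx q = vtx t ℓ i (j + 1) := by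
  rcases p with v | ⟨i', a, b, hab, hb⟩
  · simp [strip] at h
  · rw [strip] at h
    split_ifs at h with h₁ h₂
    · obtain ⟨rfl, rfl⟩ := h₁
      obtain rfl := Option.some.inj h
      exact ⟨by omega, rfl, rfl⟩
    · obtain ⟨rfl, rfl⟩ := h₁
      obtain rfl := Option.some.inj h
      exact ⟨by omega, rfl, by rw [startIdx, show b = a + 1 by omega]⟩

variable {k : Type u} [Field k]

lemma Ev_apply (v : Vtx t ℓ) (f : PSp k t ℓ) (p : PIdx t ℓ) :
    Ev k v f p = if startIdx p = v then f p else 0 := rfl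

lemma Ar_apply (i : Fin t) (j : ℕ) (f : PSp k t ℓ) (p : PIdx t ℓ) :
    Ar k i j f p = (strip i j p).elim 0 f := rfl

lemma Ev_mul_Ev (v w : Vtx t ℓ) : Ev k v * Ev k w = if v = w then Ev k v else 0 := by
  refine LinearMap.ext fun f => funext fun p => ?_
  rw [Module.End.mul_apply, Ev_apply, Ev_apply]
  by_cases h : v = w
  · subst h
    rw [if_pos rfl, Ev_apply]
    split_ifs <;> rfl
  · rw [if_neg h]
    by_cases hp : startIdx p = v
    · rw [if_pos hp, if_neg (hp ▸ h)]
      rfl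
    · rw [if_neg hp]
      rfl

lemma sum_Ev : ∑ v : Vtx t ℓ, Ev k v = 1 := by
  refine LinearMap.ext fun f => funext fun p => ?_
  rw [LinearMap.sum_apply, Finset.sum_apply]
  simp only [Ev_apply]
  rw [Finset.sum_ite_eq, if_pos (Finset.mem_univ _)]
  rfl

lemma Ev_mul_Ar_mul_Ev {i : Fin t} {j : ℕ} {v w : Vtx t ℓ}
    (h : Ev k v * Ar k i j * Ev k w ≠ 0) :
    j < ℓ i ∧ v = vtx t ℓ i j ∧ w = vtx t ℓ i (j + 1) := by
  contrapose! h
  refine LinearMap.ext fun f => funext fun p => ?_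
  rw [Module.End.mul_apply, Module.End.mul_apply, Ev_apply, Ar_apply]
  rcases hs : strip i j p with _ | q
  · exact ite_self _
  · obtain ⟨h₁, h₂, h₃⟩ := startIdx_of_strip hs
    rw [Option.elim_some, Ev_apply]
    split_ifs with hv hw
    · exact absurd (hw.symm.trans h₃) (h h₁ (hv.symm.trans h₂))
    · rfl
    · rfl

lemma Ev_mul_Ar_mul_Ev_self (i : Fin t) (j : ℕ) :
    Ev k (vtx t ℓ i j) * Ar k i j * Ev k (vtx t ℓ i (j + 1)) = Ar k i j := by
  refine LinearMap.ext fun f => funext fun p => ?_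
  rw [Module.End.mul_apply, Module.End.mul_apply, Ev_apply, Ar_apply, Ar_apply]
  rcases hs : strip i j p with _ | q
  · exact ite_self _
  · obtain ⟨-, h₂, h₃⟩ := startIdx_of_strip hs
    rw [if_pos h₂, Option.elim_some, Option.elim_some, Ev_apply, if_pos h₃]

lemma Ev_mul_mul_Ev (x y : Module.End k (PSp k t ℓ)) (v w : Vtx t ℓ) :
    Ev k v * (x * y) * Ev k w = ∑ u, Ev k v * x * Ev k u * (Ev k u * y * Ev k w) := by
  have h : ∀ u, Ev k v * x * Ev k u * (Ev k u * y * Ev k w) =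
      Ev k v * x * Ev k u * (y * Ev k w) := fun u => by
    have := Ev_mul_Ev (k := k) u u
    rw [if_pos rfl] at this
    rw [← mul_assoc, ← mul_assoc, mul_assoc _ (Ev k u) (Ev k u), this, mul_assoc _ y]
  simp only [h]
  rw [← Finset.sum_mul, ← Finset.mul_sum, sum_Ev, mul_one, mul_assoc, mul_assoc, mul_assoc]

lemma pathAlg_triangular {x : Module.End k (PSp k t ℓ)} (hx : x ∈ PathAlg k t ℓ) :
    (∀ v w, v ≠ w → ¬ vtxHeight v < vtxHeight w → Ev k v * x * Ev k w = 0) ∧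
      ∀ v, ∃ c : k, Ev k v * x * Ev k v = c • Ev k v := by
  induction hx using Algebra.adjoin_induction with
  | mem x hx =>
    rcases hx with ⟨u, rfl⟩ | ⟨i, j, rfl⟩
    · refine ⟨fun v w hvw _ => ?_, fun v => ?_⟩
      · rw [Ev_mul_Ev]
        split_ifs with h
        · rw [Ev_mul_Ev, if_neg hvw]
        · exact zero_mul _
      · rw [Ev_mul_Ev]
        split_ifs with h
        · exact ⟨1, by rw [Ev_mul_Ev, if_pos rfl, one_smul]⟩
        · exact ⟨0, by rw [zero_mul, zero_smul]⟩
    · refine ⟨fun v w _ hvw => ?_, fun v => ⟨0, ?_⟩⟩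
      · by_contra hne
        obtain ⟨hj, rfl, rfl⟩ := Ev_mul_Ar_mul_Ev hne
        exact hvw (vtxHeight_lt hj)
      · rw [zero_smul]
        by_contra hne
        obtain ⟨hj, h₁, h₂⟩ := Ev_mul_Ar_mul_Ev hne
        have := vtxHeight_lt hj
        rw [← h₁, ← h₂] at this
        exact lt_irrefl _ this
  | algebraMap c =>
    refine ⟨fun v w hvw _ => ?_, fun v => ⟨c, ?_⟩⟩
    · rw [← Algebra.commutes, mul_assoc, Ev_mul_Ev, if_neg hvw, mul_zero]
    · rw [← Algebra.commutes, mul_assoc, Ev_mul_Ev, if_pos rfl, Algebra.smul_def]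
  | add x y _ _ hx hy =>
    refine ⟨fun v w hvw hh => ?_, fun v => ?_⟩
    · rw [mul_add, add_mul, hx.1 v w hvw hh, hy.1 v w hvw hh, add_zero]
    · obtain ⟨c, hc⟩ := hx.2 v
      obtain ⟨d, hd⟩ := hy.2 v
      exact ⟨c + d, by rw [mul_add, add_mul, hc, hd, add_smul]⟩
  | mul x y _ _ hx hy =>
    refine ⟨fun v w hvw hh => ?_, fun v => ?_⟩
    · rw [Ev_mul_mul_Ev]
      refine Finset.sum_eq_zero fun u _ => ?_
      by_cases hu : v = u
      · subst hu
        rw [hy.1 v w hvw hh, mul_zero]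
      · by_cases hu' : vtxHeight v < vtxHeight u
        · by_cases huw : u = w
          · exact absurd (huw ▸ hu') hh
          · rw [hy.1 u w huw fun h => hh (hu'.trans h), mul_zero]
        · rw [hx.1 v u hu hu', zero_mul]
    · obtain ⟨c, hc⟩ := hx.2 v
      obtain ⟨d, hd⟩ := hy.2 v
      refine ⟨d * c, ?_⟩
      rw [Ev_mul_mul_Ev, Finset.sum_eq_single v, hc, hd, smul_mul_smul_comm, Ev_mul_Ev,
        if_pos rfl, mul_comm]
      · intro u _ hu
        by_cases hu' : vtxHeight v < vtxHeight u
        · rw [hy.1 u v hu hu'.asymm, mul_zero]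
        · rw [hx.1 v u hu.symm hu', zero_mul]
      · simp

end PathAlgebra

section Quotient

variable {k : Type u} [Field k] (T : ToupieAlg k)

lemma exists_subE_eq {t : ℕ} {ℓ : Fin t → ℕ} (i : Fin t) {a b : ℕ} (hab : a + 2 ≤ b) :
    ∃ z : PathAlg k t ℓ, subE i a b = arE i a * (arE i (a + 1) * z) := by
  obtain ⟨n, rfl⟩ := Nat.exists_eq_add_of_le hab
  refine ⟨((List.range n).map fun s => arE i (a + (s + 1 + 1))).prod, ?_⟩
  rw [subE, show a + 2 + n - a = n + 1 + 1 by omega, List.range_succ_eq_map, List.range_succ_eq_map]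
  simp only [List.map_cons, List.prod_cons, List.map_map]
  rfl

/-- An operator not killed by a functional vanishing on all products of two arrows
is not in the ideal. -/
lemma mkA_ne_zero {x : PathAlg k T.t T.ℓ} (f : PSp k T.t T.ℓ) (p : PIdx T.t T.ℓ)
    (hp : ∀ i j q, strip i j p = some q → ∃ v, q = .vert v) (hx : x.1 f p ≠ 0) :
    mkA T x ≠ 0 := by
  intro h
  have hI : x ∈ T.I := by
    rw [TwoSidedIdeal.mem_iff]
    exact (RingCon.eq _).1 h
  refine hx (Submodule.span_induction (p := fun y _ => y.1 f p = 0) ?_ rfl ?_ ?_ (T.adm x hI))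
  · rintro y ⟨i, a, b, hab, -, rfl⟩
    obtain ⟨z, hz⟩ := exists_subE_eq (k := k) (ℓ := T.ℓ) i hab
    rw [hz]
    change (strip i a p).elim 0 (fun q => (strip i (a + 1) q).elim 0 (z.1 f)) = 0
    rcases hs : strip i a p with _ | q
    · rfl
    · obtain ⟨v, rfl⟩ := hp i a q hs
      rfl
  · intro y z _ _ hy hz
    change y.1 f p + z.1 f p = 0
    rw [hy, hz, add_zero]
  · intro c y _ hy
    change c * y.1 f p = 0
    rw [hy, mul_zero]

lemma mkA_eV_ne_zero (v : Vtx T.t T.ℓ) : mkA T (eV v) ≠ 0 := by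
  refine mkA_ne_zero T (fun _ => 1) (.vert v) (fun i j q h => by simp [strip] at h) ?_
  change (if v = v then (1 : k) else 0) ≠ 0
  rw [if_pos rfl]
  exact one_ne_zero

lemma mkA_arE_ne_zero {i : Fin T.t} {j : ℕ} (hj : j < T.ℓ i) : mkA T (arE i j) ≠ 0 := by
  refine mkA_ne_zero T (fun _ => 1) (.sub i j (j + 1) j.lt_succ_self hj) (fun i' j' q h => ?_) ?_
  · rw [strip] at h
    split_ifs at h with h₁ h₂
    · omega
    · exact ⟨_, (Option.some.inj h).symm⟩
  · change (strip i j (.sub i j (j + 1) j.lt_succ_self hj)).elim 0 (fun _ => (1 : k)) ≠ 0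
    rw [strip, dif_pos ⟨rfl, rfl⟩, dif_neg (lt_irrefl _)]
    exact one_ne_zero

lemma mkA_smul (c : k) (x : PathAlg k T.t T.ℓ) : mkA T (c • x) = c • mkA T x := by
  rw [Algebra.smul_def, Algebra.smul_def, map_mul]
  rfl

instance : FiniteDimensional k (Alg T) :=
  Module.Finite.of_surjective
    ({ toFun := mkA T, map_add' := map_add _, map_smul' := mkA_smul T } :
      PathAlg k T.t T.ℓ →ₗ[k] Alg T) (mkA_surjective T)

instance : FiniteDimensional k (Alg T)ᵐᵒᵖ :=
  Module.Finite.equiv (MulOpposite.opLinearEquiv k : Alg T ≃ₗ[k] (Alg T)ᵐᵒᵖ)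

instance : IsNoetherianRing (Alg T)ᵐᵒᵖ := isNoetherian_of_tower k inferInstance

instance : IsArtinianRing (Alg T)ᵐᵒᵖ := isArtinian_of_tower k inferInstance

lemma actV_mul_mul_actV (x : PathAlg k T.t T.ℓ) (v w : Vtx T.t T.ℓ) :
    actV T w * op (mkA T x) * actV T v = op (mkA T (eV v * x * eV w)) := by
  rw [actV, actV, ← op_mul, ← op_mul, ← map_mul, ← map_mul, mul_assoc]

/-- The trivial paths form a triangular system of idempotents of a toupie algebra. -/
def vertexIdempotents : TriangularIdempotents k (Alg T)ᵐᵒᵖ (Vtx T.t T.ℓ) where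
  ε := actV T
  height := vtxHeight
  complete :=
    { idem := fun v => by
        change actV T v * actV T v = actV T v
        rw [actV, ← op_mul, ← map_mul]
        refine congrArg (fun x => op (mkA T x)) (Subtype.ext ?_)
        exact (Ev_mul_Ev v v).trans (if_pos rfl)
      ortho := fun v w hvw => by
        change actV T v * actV T w = 0
        rw [actV, actV, ← op_mul, ← map_mul, ← op_zero, ← map_zero (mkA T)]
        refine congrArg (fun x => op (mkA T x)) (Subtype.ext ?_)
        exact (Ev_mul_Ev w v).trans (if_neg hvw.symm)
      complete := by
        simp only [actV]
        rw [← Finset.op_sum, ← map_sum, ← op_one, ← map_one (mkA T)]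
        refine congrArg (fun x => op (mkA T x)) (Subtype.ext ?_)
        rw [AddSubmonoidClass.coe_finsetSum]
        exact sum_Ev }
  ne_zero v h := mkA_eV_ne_zero T v (congrArg unop h)
  triangular x v w hvw hh := by
    obtain ⟨x, rfl⟩ := op_surjective x
    obtain ⟨x, rfl⟩ := mkA_surjective T x
    rw [actV_mul_mul_actV, ← op_zero, ← map_zero (mkA T)]
    exact congrArg (fun x => op (mkA T x)) (Subtype.ext ((pathAlg_triangular x.2).1 v w hvw hh))
  diagonal x v := by
    obtain ⟨x, rfl⟩ := op_surjective x
    obtain ⟨x, rfl⟩ := mkA_surjective T x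
    obtain ⟨c, hc⟩ := (pathAlg_triangular x.2).2 v
    refine ⟨c, ?_⟩
    rw [actV_mul_mul_actV, actV, ← op_smul, ← mkA_smul]
    exact congrArg (fun x => op (mkA T x)) (Subtype.ext hc)

lemma arrow_ne_zero {i : Fin T.t} {j : ℕ} (hj : j < T.ℓ i) :
    (vertexIdempotents T).ε (vtx T.t T.ℓ i (j + 1)) * op (mkA T (arE i j)) *
      (vertexIdempotents T).ε (vtx T.t T.ℓ i j) ≠ 0 := by
  intro h
  change actV T _ * _ * actV T _ = 0 at h
  rw [actV_mul_mul_actV] at h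
  apply mkA_arE_ne_zero T hj
  have h₁ : eV (vtx T.t T.ℓ i j) * arE i j * eV (vtx T.t T.ℓ i (j + 1)) =
      (arE i j : PathAlg k T.t T.ℓ) := Subtype.ext (Ev_mul_Ar_mul_Ev_self i j)
  rw [← h₁]
  exact congrArg unop h

lemma linked_chain_proj (v : Vtx T.t T.ℓ) :
    Relation.ReflTransGen Linked (ModuleCat.of (Alg T)ᵐᵒᵖ ((vertexIdempotents T).proj v))
      (ModuleCat.of (Alg T)ᵐᵒᵖ ((vertexIdempotents T).proj Vtx.src)) := by
  obtain ⟨i, j, hj, rfl⟩ := exists_eq_vtx (by have := T.ht; omega) T.hℓ v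
  induction j with
  | zero => exact .refl
  | succ j ih =>
    exact .head ((vertexIdempotents T).linked_proj_proj (arrow_ne_zero T hj)) (ih (by omega))

lemma linked_chain_inj (v : Vtx T.t T.ℓ) :
    Relation.ReflTransGen Linked (ModuleCat.of (Alg T)ᵐᵒᵖ ((vertexIdempotents T).inj Vtx.snk))
      (ModuleCat.of (Alg T)ᵐᵒᵖ ((vertexIdempotents T).inj v)) := by
  obtain ⟨i, j, hj, rfl⟩ := exists_eq_vtx (by have := T.ht; omega) T.hℓ v
  induction hj using Nat.decreasingInduction with
  | self => rw [vtx_length (T.hℓ i)]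
  | of_succ j hj ih =>
    exact ih.tail ((vertexIdempotents T).linked_inj_inj (arrow_ne_zero T hj))

lemma linked_source_sink (hm : 0 < mDim T) :
    Linked (ModuleCat.of (Alg T)ᵐᵒᵖ ((vertexIdempotents T).proj Vtx.src))
      (ModuleCat.of (Alg T)ᵐᵒᵖ ((vertexIdempotents T).inj Vtx.snk)) := by
  have : Nontrivial (LinearMap.range (lrMap T)) := Module.nontrivial_of_finrank_pos hm
  obtain ⟨⟨_, x, rfl⟩, hx⟩ := exists_ne (0 : LinearMap.range (lrMap T))
  refine (vertexIdempotents T).linked_proj_inj (x := op x) fun h => hx (Subtype.ext ?_)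
  change e0 T * x * einf T = 0
  rw [mul_assoc]
  exact congrArg unop h

lemma linked_chain_of_projective_of_injective (hm : 0 < mDim T)
    {X Y : ModuleCat.{u} (Alg T)ᵐᵒᵖ} (hX : Indec (Alg T)ᵐᵒᵖ X) (hX' : FdMod (Alg T)ᵐᵒᵖ X)
    (hXI : Module.Injective (Alg T)ᵐᵒᵖ X) (hY : Indec (Alg T)ᵐᵒᵖ Y) (hY' : FdMod (Alg T)ᵐᵒᵖ Y)
    (hYP : Module.Projective (Alg T)ᵐᵒᵖ Y) : Relation.ReflTransGen Linked Y X := by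
  obtain ⟨v, hv⟩ := (vertexIdempotents T).exists_linked_proj hY hY' hYP
  obtain ⟨w, hw⟩ := (vertexIdempotents T).exists_linked_inj hX hX' hXI
  exact .head hv ((linked_chain_proj T v).trans
    (.head (linked_source_sink T hm) ((linked_chain_inj T w).tail hw)))

end Quotient

end Toupie

namespace Toupie

/-- Let `A = kQ/I` be a non simply connected toupie algebra with
`m = dim_k e₀ A e∞ > 0`.  If `A` is weakly shod, then every IP-path in `ind A` is
trivial: there is no path of positive length from an indecomposable injective module to
an indecomposable projective module. -/
theorem ip_paths_trivial_of_weaklyShod {k : Type u} [Field k] (T : ToupieAlg k)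
    (hnsc : ¬ SimplyConnected T) (hm : 0 < mDim T) (hws : WeaklyShod (Alg T)ᵐᵒᵖ) :
    ∀ X Y : ModuleCat.{u} (Alg T)ᵐᵒᵖ,
      Indec (Alg T)ᵐᵒᵖ X → FdMod (Alg T)ᵐᵒᵖ X → Module.Injective (Alg T)ᵐᵒᵖ X →
      Indec (Alg T)ᵐᵒᵖ Y → FdMod (Alg T)ᵐᵒᵖ Y → Module.Projective (Alg T)ᵐᵒᵖ Y →
      ¬ Relation.TransGen (Step (Alg T)ᵐᵒᵖ) X Y := by
  intro X Y hX hX' hXI hY hY' hYP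
  exact not_transGen_of_weaklyShod hws hX hX' hXI hYP
    (linked_chain_of_projective_of_injective T hm hX hX' hXI hY hY' hYP)

end Toupie
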